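/- arXiv:1904.07626 — 2 statements merged into one kernel-verified Lean document; each statement's English description precedes it below -/
import Mathlib

section
/- Let q ≥ 4 be a prime power and let K be a finite field extension of F, with Z = |K|. Then the number of codewords g of the extended Veronese code C_q(K) with wt(g) = q^2 + q + 1 (full support) equals (Z−1)·(Z−q)·( 24Z^4 − 24q^2·Z^3 + (12q^4 − 12q)·Z^2 − (4q^6 − 4q^5 + 8q^4 − 20q^3 + 12q^2)·Z + (q^8 − 4q^7 + 11q^6 − 17q^5 + 12q^4 − 3q^3) )/24. -/
noncomputable section

open MvPolynomial

/-- The projective plane over `F`: the projectivization of `F^3`. -/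
abbrev Plane (F : Type*) [Field F] := Projectivization F (Fin 3 → F)

/-- The extended Veronese code over a field extension `K` of `F`: evaluations of
homogeneous degree-2 polynomials with coefficients in `K` at the chosen representatives
of the points of the projective plane over `F`, regarded as vectors of `K^3`. -/
def VeroneseCodeExt {F : Type*} [Field F] (K : Type*) [Field K] [Algebra F K]
    (rep : Plane F → (Fin 3 → F)) : Submodule K (Plane F → K) :=
  (MvPolynomial.homogeneousSubmodule (Fin 3) K 2).map
    (LinearMap.pi fun p =>
      (MvPolynomial.aeval (fun i => algebraMap F K (rep p i))).toLinearMap)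

/-- The (Hamming) weight of a word: the size of its support. -/
def wt {α K : Type*} [Zero K] (g : α → K) : ℕ := Nat.card {p | g p ≠ 0}

set_option linter.unusedSectionVars false
set_option linter.unusedSimpArgs false

namespace Ver

open Classical
variable {F K : Type*} [Field F] [Fintype F] [Field K] [Fintype K] [Algebra F K]

abbrev V3 (F : Type*) := Fin 3 → F
abbrev QM (F K : Type*) [Field F] [Field K] [Algebra F K] := QuadraticMap F (V3 F) K
abbrev B3 (F : Type*) [Field F] := Module.Basis (Fin 3) F (V3 F)

noncomputable instance : Fintype (QM F K) :=
  @Fintype.ofFinite _ (Finite.of_injective (fun Q : QM F K => (Q : V3 F → K)) DFunLike.coe_injective)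
noncomputable instance : Fintype (V3 F →ₗ[F] F) :=
  @Fintype.ofFinite _ (Finite.of_injective (fun Q : V3 F →ₗ[F] F => (Q : V3 F → F)) DFunLike.coe_injective)

local notation "ι" => algebraMap F K

/-- the quadratic map with given coefficients in a basis -/
def mk6 (b : B3 F) (a1 a2 a3 a4 a5 a6 : K) : QM F K where
  toFun v := ι (b.coord 0 v) ^ 2 * a1 + ι (b.coord 1 v) ^ 2 * a2 + ι (b.coord 2 v) ^ 2 * a3
    + ι (b.coord 1 v) * ι (b.coord 2 v) * a4 + ι (b.coord 2 v) * ι (b.coord 0 v) * a5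
    + ι (b.coord 0 v) * ι (b.coord 1 v) * a6
  toFun_smul c v := by
    simp only [map_smul, smul_eq_mul, map_mul]
    rw [Algebra.smul_def, map_mul]; ring
  exists_companion' := by
    refine ⟨LinearMap.mk₂ F (fun v w =>
      2 * ι (b.coord 0 v) * ι (b.coord 0 w) * a1 + 2 * ι (b.coord 1 v) * ι (b.coord 1 w) * a2
      + 2 * ι (b.coord 2 v) * ι (b.coord 2 w) * a3
      + (ι (b.coord 1 v) * ι (b.coord 2 w) + ι (b.coord 1 w) * ι (b.coord 2 v)) * a4
      + (ι (b.coord 2 v) * ι (b.coord 0 w) + ι (b.coord 2 w) * ι (b.coord 0 v)) * a5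
      + (ι (b.coord 0 v) * ι (b.coord 1 w) + ι (b.coord 0 w) * ι (b.coord 1 v)) * a6)
      ?_ ?_ ?_ ?_, ?_⟩
    all_goals intros
    all_goals simp only [map_smul, smul_eq_mul, map_mul, map_add, LinearMap.mk₂_apply]
    all_goals try rw [Algebra.smul_def]
    all_goals ring

def vec (b : B3 F) (x y z : F) : V3 F := x • b 0 + y • b 1 + z • b 2

theorem vec_coord (b : B3 F) (v : V3 F) : vec b (b.coord 0 v) (b.coord 1 v) (b.coord 2 v) = v := by
  have := b.sum_repr v
  rw [Fin.sum_univ_three] at this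
  simpa [vec] using this

@[simp] theorem coord_vec0 (b : B3 F) (x y z : F) : b.coord 0 (vec b x y z) = x := by
  simp [vec, Finsupp.single_apply]
@[simp] theorem coord_vec1 (b : B3 F) (x y z : F) : b.coord 1 (vec b x y z) = y := by
  simp [vec, Finsupp.single_apply]
@[simp] theorem coord_vec2 (b : B3 F) (x y z : F) : b.coord 2 (vec b x y z) = z := by
  simp [vec, Finsupp.single_apply]

theorem sum_vec (b : B3 F) (f : V3 F → ℚ) : ∑ v, f v = ∑ x, ∑ y, ∑ z, f (vec b x y z) := by
  rw [← Fintype.sum_prod_type' (f := fun x y => ∑ z, f (vec b x y z))]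
  rw [← Fintype.sum_prod_type' (f := fun (xy : F × F) z => f (vec b xy.1 xy.2 z))]
  symm
  refine Fintype.sum_bijective (fun t : (F × F) × F => vec b t.1.1 t.1.2 t.2) ⟨?_, ?_⟩ _ _ (fun _ => rfl)
  · rintro ⟨⟨x, y⟩, z⟩ ⟨⟨x', y'⟩, z'⟩ h
    have h0 := congrArg (b.coord 0) h
    have h1 := congrArg (b.coord 1) h
    have h2 := congrArg (b.coord 2) h
    simp only [coord_vec0, coord_vec1, coord_vec2] at h0 h1 h2
    subst h0 h1 h2; rfl
  · intro v
    exact ⟨((b.coord 0 v, b.coord 1 v), b.coord 2 v), vec_coord b v⟩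

theorem mk6_vec (b : B3 F) (a1 a2 a3 a4 a5 a6 : K) (x y z : F) :
    mk6 b a1 a2 a3 a4 a5 a6 (vec b x y z) = ι x ^ 2 * a1 + ι y ^ 2 * a2 + ι z ^ 2 * a3
      + ι y * ι z * a4 + ι z * ι x * a5 + ι x * ι y * a6 := by
  change ι (b.coord 0 _) ^ 2 * a1 + ι (b.coord 1 _) ^ 2 * a2 + ι (b.coord 2 _) ^ 2 * a3
    + ι (b.coord 1 _) * ι (b.coord 2 _) * a4 + ι (b.coord 2 _) * ι (b.coord 0 _) * a5
    + ι (b.coord 0 _) * ι (b.coord 1 _) * a6 = _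
  simp only [coord_vec0, coord_vec1, coord_vec2]

theorem vec_e0 (b : B3 F) : b 0 = vec b 1 0 0 := by simp [vec]
theorem vec_e1 (b : B3 F) : b 1 = vec b 0 1 0 := by simp [vec]
theorem vec_e2 (b : B3 F) : b 2 = vec b 0 0 1 := by simp [vec]

theorem eq_mk6 (b : B3 F) (Q : QM F K) : Q = mk6 b (Q (b 0)) (Q (b 1)) (Q (b 2))
    (QuadraticMap.polar Q (b 1) (b 2)) (QuadraticMap.polar Q (b 2) (b 0))
    (QuadraticMap.polar Q (b 0) (b 1)) := by
  ext v
  rw [← vec_coord b v, mk6_vec]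
  generalize b.coord 0 v = x; generalize b.coord 1 v = y; generalize b.coord 2 v = z
  rw [vec, QuadraticMap.map_add Q, QuadraticMap.map_add Q, QuadraticMap.polar_add_left]
  simp only [QuadraticMap.map_smul, QuadraticMap.polar_smul_left, QuadraticMap.polar_smul_right,
    Algebra.smul_def (A := K), map_mul]
  rw [QuadraticMap.polar_comm Q (b 0) (b 2)]
  ring

theorem sum_QM (b : B3 F) (f : QM F K → ℚ) : ∑ Q, f Q =
    ∑ a1, ∑ a2, ∑ a3, ∑ a4, ∑ a5, ∑ a6, f (mk6 b a1 a2 a3 a4 a5 a6) := by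
  have : ∑ a1, ∑ a2, ∑ a3, ∑ a4, ∑ a5, ∑ a6, f (mk6 b a1 a2 a3 a4 a5 a6) =
      ∑ t : K × K × K × K × K × K, f (mk6 b t.1 t.2.1 t.2.2.1 t.2.2.2.1 t.2.2.2.2.1 t.2.2.2.2.2) := by
    simp only [Fintype.sum_prod_type]
  rw [this]
  symm
  refine Fintype.sum_bijective (fun t : K × K × K × K × K × K => mk6 b t.1 t.2.1 t.2.2.1 t.2.2.2.1 t.2.2.2.2.1 t.2.2.2.2.2) ⟨?_, ?_⟩ _ _ (fun _ => rfl)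
  · rintro ⟨a1, a2, a3, a4, a5, a6⟩ ⟨c1, c2, c3, c4, c5, c6⟩ h
    have H : ∀ x y z : F, mk6 b a1 a2 a3 a4 a5 a6 (vec b x y z) = mk6 b c1 c2 c3 c4 c5 c6 (vec b x y z) :=
      fun x y z => congrArg (fun Q : QM F K => Q (vec b x y z)) h
    simp only [mk6_vec] at H
    have h1 := H 1 0 0
    have h2 := H 0 1 0
    have h3 := H 0 0 1
    have h4 := H 0 1 1
    have h5 := H 1 0 1
    have h6 := H 1 1 0
    simp at h1 h2 h3
    subst h1 h2 h3
    simp at h4 h5 h6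
    subst h4 h5 h6; rfl
  · intro Q
    exact ⟨⟨_, _, _, _, _, _⟩, (eq_mk6 b Q).symm⟩

theorem exists_basis (v1 v2 v3 : V3 F) (h1 : v1 ≠ 0) (h2 : v2 ∉ Submodule.span F {v1})
    (h3 : v3 ∉ Submodule.span F {v1, v2}) : ∃ b : B3 F, b 0 = v1 ∧ b 1 = v2 ∧ b 2 = v3 := by
  have hli : LinearIndependent F ![v3, v2, v1] := by
    refine linearIndependent_finCons.2 ⟨linearIndependent_finCons.2 ⟨linearIndependent_finCons.2
      ⟨linearIndependent_empty_type, ?_⟩, ?_⟩, ?_⟩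
    · simpa using h1
    · simpa using h2
    · simpa [Set.pair_comm] using h3
  have hli' : LinearIndependent F ![v1, v2, v3] := by
    have := hli.comp Fin.rev Fin.rev_injective
    convert this using 1
    ext i j; fin_cases i <;> rfl
  exact ⟨basisOfLinearIndependentOfCardEqFinrank hli' (by simp), by simp, by simp, by simp⟩

theorem exists_notMem (s : Submodule F (V3 F)) (h : Module.finrank F s < 3) : ∃ v, v ∉ s := by
  by_contra! hc
  have : s = ⊤ := by ext v; simp [hc v]
  subst this
  simp at h

theorem finrank_span1 (v : V3 F) (h1 : v ≠ 0) : Module.finrank F (Submodule.span F {v}) = 1 :=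
  finrank_span_singleton h1

theorem finrank_span2 (v1 v2 : V3 F) (h1 : v1 ≠ 0) (h2 : v2 ∉ Submodule.span F {v1}) :
    Module.finrank F (Submodule.span F {v1, v2}) = 2 := by
  have hli : LinearIndependent F ![v2, v1] := by
    refine linearIndependent_finCons.2 ⟨linearIndependent_finCons.2
      ⟨linearIndependent_empty_type, ?_⟩, ?_⟩
    · simpa using h1
    · simpa using h2
  have := finrank_span_eq_card hli
  have hr : Set.range ![v2, v1] = {v1, v2} := by
    rw [Matrix.range_cons, Matrix.range_cons, Matrix.range_empty, Set.union_empty, Set.union_comm]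
    rfl
  rw [← hr, this]; rfl

theorem exists_basis2 (v1 v2 : V3 F) (h1 : v1 ≠ 0) (h2 : v2 ∉ Submodule.span F {v1}) :
    ∃ b : B3 F, b 0 = v1 ∧ b 1 = v2 := by
  obtain ⟨v3, h3⟩ := exists_notMem (Submodule.span F {v1, v2}) (by rw [finrank_span2 v1 v2 h1 h2]; norm_num)
  obtain ⟨b, hb⟩ := exists_basis v1 v2 v3 h1 h2 h3
  exact ⟨b, hb.1, hb.2.1⟩

theorem exists_basis1 (v1 : V3 F) (h1 : v1 ≠ 0) :
    ∃ b : B3 F, b 0 = v1 := by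
  obtain ⟨v3, h3⟩ := exists_notMem (Submodule.span F {v1}) (by rw [finrank_span1 v1 h1]; norm_num)
  obtain ⟨b, hb⟩ := exists_basis2 v1 v3 h1 h3
  exact ⟨b, hb.1⟩

theorem exists_basis_dual (l : V3 F →ₗ[F] F) (hl : l ≠ 0) :
    ∃ b : B3 F, ∀ x y z, l (vec b x y z) = z := by
  obtain ⟨u, hu⟩ : ∃ u, l u ≠ 0 := by
    by_contra! h; exact hl (LinearMap.ext h)
  have hk : Module.finrank F (LinearMap.ker l) = 2 := by
    have := LinearMap.finrank_range_add_finrank_ker l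
    have hs : LinearMap.range l = ⊤ := LinearMap.range_eq_top.2 (LinearMap.surjective hl)
    rw [hs] at this
    simp at this
    omega
  let c := Module.finBasisOfFinrankEq F (LinearMap.ker l) hk
  have h1 : (c 0 : V3 F) ≠ 0 := by simpa using c.ne_zero 0
  have hsp : ∀ v ∈ Submodule.span F {(c 0 : V3 F), (c 1 : V3 F)}, l v = 0 := by
    intro v hv
    have : Submodule.span F {(c 0 : V3 F), (c 1 : V3 F)} ≤ LinearMap.ker l := by
      rw [Submodule.span_le]; rintro x (rfl | rfl) <;> simp
    exact this hv
  have h2 : (c 1 : V3 F) ∉ Submodule.span F {(c 0 : V3 F)} := by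
    intro h
    obtain ⟨t, ht⟩ := Submodule.mem_span_singleton.1 h
    have h' : t • c 0 = c 1 := Subtype.ext ht
    have := congrArg (fun w => c.repr w 1) h'
    simp at this
  obtain ⟨b, hb0, hb1, hb2⟩ := exists_basis (c 0 : V3 F) (c 1) ((l u)⁻¹ • u) h1 h2
    (fun h => by have := hsp _ h; simp [hu] at this)
  refine ⟨b, fun x y z => ?_⟩
  have e0 : l (b 0) = 0 := by rw [hb0]; exact (c 0).2
  have e1 : l (b 1) = 0 := by rw [hb1]; exact (c 1).2
  simp [vec, e0, e1, hb2, hu]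



/-- number of nonzero zeros -/
def zn (Q : QM F K) : ℚ := ∑ v : V3 F, if v ≠ 0 ∧ Q v = 0 then 1 else 0

/-- the form vanishes on a plane of the vector space (a line of the projective plane) -/
def IsT (Q : QM F K) : Prop := ∃ l : V3 F →ₗ[F] F, l ≠ 0 ∧ ∀ v, l v = 0 → Q v = 0

theorem sum_mem (s : Submodule F (V3 F)) {k : ℕ} (h : Module.finrank F s = k) :
    ∑ v : V3 F, (if v ∈ s then (1 : ℚ) else 0) = (Fintype.card F : ℚ) ^ k := by
  rw [Finset.sum_boole]
  have := Module.card_eq_pow_finrank (K := F) (V := s)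
  rw [h] at this
  rw [← Nat.cast_pow, ← this, Fintype.card_subtype]

theorem sum_notMem (s : Submodule F (V3 F)) {k : ℕ} (h : Module.finrank F s = k) :
    ∑ v : V3 F, (if v ∉ s then (1 : ℚ) else 0) = (Fintype.card F : ℚ) ^ 3 - (Fintype.card F : ℚ) ^ k := by
  rw [← sum_mem s h, eq_sub_iff_add_eq, ← Finset.sum_add_distrib]
  rw [Finset.sum_congr rfl (g := fun _ => (1 : ℚ))]
  · simp
  · intro v _
    by_cases hv : v ∈ s <;> simp [hv]

theorem sum_ne_zero : ∑ v : V3 F, (if v ≠ 0 then (1 : ℚ) else 0) = (Fintype.card F : ℚ) ^ 3 - 1 := by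
  have := sum_notMem (F := F) ⊥ (k := 0) (by simp)
  simpa using this

theorem sum1 (v : V3 F) (hv : v ≠ 0) :
    ∑ Q : QM F K, (if Q v = 0 then (1 : ℚ) else 0) = (Fintype.card K : ℚ) ^ 5 := by
  obtain ⟨b, rfl⟩ := exists_basis1 v hv
  rw [sum_QM b, vec_e0 b]
  simp [mk6_vec]
  ring

theorem sum2 (v w : V3 F) (hv : v ≠ 0) (hw : w ∉ Submodule.span F {v}) :
    ∑ Q : QM F K, (if Q v = 0 ∧ Q w = 0 then (1 : ℚ) else 0) = (Fintype.card K : ℚ) ^ 4 := by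
  obtain ⟨b, rfl, rfl⟩ := exists_basis2 v w hv hw
  rw [sum_QM b, vec_e0 b, vec_e1 b]
  simp [mk6_vec, ite_and]
  ring

theorem S1 : ∑ Q : QM F K, zn Q = ((Fintype.card F : ℚ) ^ 3 - 1) * (Fintype.card K : ℚ) ^ 5 := by
  unfold zn
  rw [Finset.sum_comm, ← sum_ne_zero, Finset.sum_mul]
  refine Finset.sum_congr rfl fun v _ => ?_
  by_cases hv : v = 0
  · simp [hv]
  · simp only [ne_eq, hv, not_false_eq_true, true_and, if_true, one_mul]
    exact sum1 v hv

theorem zn_split1 (Q : QM F K) (v : V3 F) (hv : v ≠ 0) (hQ : Q v = 0) :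
    ∑ w : V3 F, (if w ∉ Submodule.span F {v} ∧ Q w = 0 then (1 : ℚ) else 0) =
      zn Q - ((Fintype.card F : ℚ) - 1) := by
  have h1 := sum_mem _ (finrank_span1 v hv)
  have h0 : ∑ w : V3 F, (if w = 0 then (1 : ℚ) else 0) = 1 := by simp
  rw [pow_one] at h1
  rw [eq_sub_iff_add_eq]
  nth_rewrite 1 [← h1]
  rw [← h0, ← Finset.sum_sub_distrib, ← Finset.sum_add_distrib]
  refine Finset.sum_congr rfl fun w _ => ?_
  by_cases hw : w ∈ Submodule.span F {v}
  · have hQw : Q w = 0 := by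
      obtain ⟨t, rfl⟩ := Submodule.mem_span_singleton.1 hw
      simp [QuadraticMap.map_smul, hQ]
    by_cases hw0 : w = 0 <;> simp [hw, hw0, hQw]
  · have hw0 : w ≠ 0 := by rintro rfl; simp at hw
    simp [hw, hw0]

theorem S2 : ∑ Q : QM F K, zn Q * (zn Q - ((Fintype.card F : ℚ) - 1)) =
    ((Fintype.card F : ℚ) ^ 3 - 1) * ((Fintype.card F : ℚ) ^ 3 - Fintype.card F) *
      (Fintype.card K : ℚ) ^ 4 := by
  have key : ∀ Q : QM F K, zn Q * (zn Q - ((Fintype.card F : ℚ) - 1)) =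
      ∑ v : V3 F, ∑ w : V3 F, if v ≠ 0 ∧ w ∉ Submodule.span F {v} then
        (if Q v = 0 ∧ Q w = 0 then (1 : ℚ) else 0) else 0 := by
    intro Q
    conv_lhs => enter [1]; unfold zn
    rw [Finset.sum_mul]
    refine Finset.sum_congr rfl fun v _ => ?_
    by_cases hv : v ≠ 0 ∧ Q v = 0
    · rw [← zn_split1 Q v hv.1 hv.2]
      simp only [hv, if_true, one_mul, ne_eq, not_false_eq_true, true_and]
      refine Finset.sum_congr rfl fun w _ => ?_
      split_ifs <;> simp_all
    · rw [if_neg hv, zero_mul]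
      symm; apply Finset.sum_eq_zero; intro w _
      split_ifs <;> simp_all
  simp only [key]
  rw [Finset.sum_comm, ← sum_ne_zero, mul_assoc, Finset.sum_mul]
  refine Finset.sum_congr rfl fun v _ => ?_
  by_cases hv : v = 0
  · simp [hv]
  · rw [Finset.sum_comm]
    have := sum_notMem _ (finrank_span1 v hv)
    rw [pow_one] at this
    rw [← this]
    simp only [ne_eq, hv, not_false_eq_true, true_and, if_true, one_mul]
    rw [Finset.sum_mul]
    refine Finset.sum_congr rfl fun w _ => ?_
    by_cases hw : w ∈ Submodule.span F {v}
    · simp [hw]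
    · simp only [hw, not_false_eq_true, if_true, one_mul]
      exact sum2 v w hv hw

theorem mem_span2 (b : B3 F) (x y z : F) : vec b x y z ∈ Submodule.span F {b 0, b 1} ↔ z = 0 := by
  rw [Submodule.mem_span_pair]
  constructor
  · rintro ⟨s, t, h⟩
    have h' : vec b s t 0 = vec b x y z := by rw [← h]; simp [vec]
    simpa only [coord_vec2] using (congrArg (b.coord 2) h').symm
  · rintro rfl
    exact ⟨x, y, by simp [vec]⟩

theorem vec_eq_zero (b : B3 F) (x y z : F) : vec b x y z = 0 ↔ x = 0 ∧ y = 0 ∧ z = 0 := by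
  constructor
  · intro h
    refine ⟨?_, ?_, ?_⟩
    · simpa only [coord_vec0, map_zero] using congrArg (b.coord 0) h
    · simpa only [coord_vec1, map_zero] using congrArg (b.coord 1) h
    · simpa only [coord_vec2, map_zero] using congrArg (b.coord 2) h
  · rintro ⟨rfl, rfl, rfl⟩; simp [vec]

theorem isT_of (b : B3 F) (l1 l2 l3 : F) (h : l1 ≠ 0 ∨ l2 ≠ 0 ∨ l3 ≠ 0) (Q : QM F K)
    (hQ : ∀ x y z, l1 * x + l2 * y + l3 * z = 0 → Q (vec b x y z) = 0) : IsT Q := by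
  refine ⟨l1 • b.coord 0 + l2 • b.coord 1 + l3 • b.coord 2, ?_, ?_⟩
  · intro h0
    have h1 := congrArg (fun l => l (vec b 1 0 0)) h0
    have h2 := congrArg (fun l => l (vec b 0 1 0)) h0
    have h3 := congrArg (fun l => l (vec b 0 0 1)) h0
    simp only [LinearMap.add_apply, LinearMap.smul_apply, coord_vec0, coord_vec1, coord_vec2] at h1 h2 h3
    simp at h1 h2 h3
    tauto
  · intro v
    rw [← vec_coord b v]
    intro hv
    apply hQ
    simpa only [LinearMap.add_apply, LinearMap.smul_apply, coord_vec0, coord_vec1, coord_vec2, smul_eq_mul] using hv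

theorem zn_split2 (Q : QM F K) (hT : ¬ IsT Q) (v w : V3 F) (hv : v ≠ 0) (hw : w ∉ Submodule.span F {v})
    (hQ : Q v = 0) (hQw : Q w = 0) :
    ∑ u : V3 F, (if u ∉ Submodule.span F {v, w} ∧ Q u = 0 then (1 : ℚ) else 0) =
      zn Q - 2 * ((Fintype.card F : ℚ) - 1) := by
  obtain ⟨b, rfl, rfl⟩ := exists_basis2 v w hv hw
  have hm := eq_mk6 b Q
  rw [hQ, hQw] at hm
  generalize Q (b 2) = a3, QuadraticMap.polar Q (b 1) (b 2) = a4,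
    QuadraticMap.polar Q (b 2) (b 0) = a5, QuadraticMap.polar Q (b 0) (b 1) = a6 at hm
  have ha6 : a6 ≠ 0 := by
    rintro rfl
    apply hT
    refine isT_of b 0 0 1 (by simp) Q ?_
    intro x y z h
    have : z = 0 := by simpa using h
    rw [hm, mk6_vec, this]; simp
  have h2 : ∑ x : F, ∑ y : F, ∑ z : F, ((if x = 0 then (1:ℚ) else 0) * (if z = 0 then (1:ℚ) else 0)
      + (if y = 0 then (1:ℚ) else 0) * (if z = 0 then (1:ℚ) else 0)
      - 2 * (if x = 0 then (1:ℚ) else 0) * (if y = 0 then (1:ℚ) else 0) * (if z = 0 then (1:ℚ) else 0)) =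
      2 * ((Fintype.card F : ℚ) - 1) := by
    simp [Finset.sum_add_distrib, Finset.sum_sub_distrib, ← Finset.mul_sum]
    ring
  rw [← h2, eq_sub_iff_add_eq, zn, sum_vec b, sum_vec b]
  simp only [← Finset.sum_add_distrib]
  refine Finset.sum_congr rfl fun x _ => Finset.sum_congr rfl fun y _ => Finset.sum_congr rfl fun z _ => ?_
  simp only [mem_span2, ne_eq, vec_eq_zero]
  by_cases hz : z = 0
  · have : Q (vec b x y z) = 0 ↔ x = 0 ∨ y = 0 := by
      rw [hm, mk6_vec]; simp [hz, ha6]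
    simp only [this]
    by_cases hx : x = 0 <;> by_cases hy : y = 0 <;> simp [hx, hy, hz]
    norm_num
  · simp [hz]

theorem triple (Q : QM F K) (hT : ¬ IsT Q) :
    zn Q * (zn Q - ((Fintype.card F : ℚ) - 1)) * (zn Q - 2 * ((Fintype.card F : ℚ) - 1)) =
    ∑ v : V3 F, ∑ w : V3 F, ∑ u : V3 F,
      if v ≠ 0 ∧ w ∉ Submodule.span F {v} ∧ u ∉ Submodule.span F {v, w} then
        (if Q v = 0 ∧ Q w = 0 ∧ Q u = 0 then (1 : ℚ) else 0) else 0 := by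
  conv_lhs => enter [1, 1]; unfold zn
  rw [Finset.sum_mul, Finset.sum_mul]
  refine Finset.sum_congr rfl fun v _ => ?_
  by_cases hv : v ≠ 0 ∧ Q v = 0
  · rw [← zn_split1 Q v hv.1 hv.2]
    simp only [hv, if_true, one_mul, ne_eq, not_false_eq_true, true_and]
    rw [Finset.sum_mul]
    refine Finset.sum_congr rfl fun w _ => ?_
    by_cases hw : w ∉ Submodule.span F {v} ∧ Q w = 0
    · rw [← zn_split2 Q hT v w hv.1 hw.1 hv.2 hw.2]
      simp only [hw, if_true, one_mul, not_false_eq_true, true_and]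
      refine Finset.sum_congr rfl fun u _ => ?_
      split_ifs <;> simp_all
    · rw [if_neg hw, zero_mul]
      symm; apply Finset.sum_eq_zero; intro u _
      split_ifs <;> simp_all
  · rw [if_neg hv, zero_mul, zero_mul]
    symm; apply Finset.sum_eq_zero; intro w _
    apply Finset.sum_eq_zero; intro u _
    split_ifs <;> simp_all


theorem isT_mk6_iff (e : B3 F) (a b c : K) :
    IsT (mk6 e 0 0 0 a b c) ↔ a = 0 ∨ b = 0 ∨ c = 0 := by
  constructor
  · rintro ⟨l, hl, H⟩
    by_contra! hne
    obtain ⟨ha, hb, hc⟩ := hne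
    have hlv : ∀ x y z, l (vec e x y z) = x * l (e 0) + y * l (e 1) + z * l (e 2) := by
      intro x y z; simp [vec]
    have H' : ∀ x y z : F, x * l (e 0) + y * l (e 1) + z * l (e 2) = 0 →
        ι y * ι z * a + ι z * ι x * b + ι x * ι y * c = 0 := by
      intro x y z h
      have := H (vec e x y z) (by rw [hlv, h])
      rw [mk6_vec] at this
      simpa using this
    have hl' : l (e 0) ≠ 0 ∨ l (e 1) ≠ 0 ∨ l (e 2) ≠ 0 := by
      by_contra! h0
      apply hl
      refine LinearMap.ext fun v => ?_
      rw [← vec_coord e v, hlv, h0.1, h0.2.1, h0.2.2]; simp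
    generalize l (e 0) = l1 at *
    generalize l (e 1) = l2 at *
    generalize l (e 2) = l3 at *
    have h12 := H' l2 (-l1) 0 (by ring)
    have h13 := H' l3 0 (-l1) (by ring)
    have h23 := H' 0 l3 (-l2) (by ring)
    simp [ha, hb, hc] at h12 h13 h23
    have k12 : l1 = 0 → l2 = 0 → False := by
      intro h1 h2
      have := H' 1 1 0 (by rw [h1, h2]; ring)
      simp [hc] at this
    have k13 : l1 = 0 → l3 = 0 → False := by
      intro h1 h2
      have := H' 1 0 1 (by rw [h1, h2]; ring)
      simp [hb] at this
    have k23 : l2 = 0 → l3 = 0 → False := by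
      intro h1 h2
      have := H' 0 1 1 (by rw [h1, h2]; ring)
      simp [ha] at this
    tauto
  · intro h
    rcases h with rfl | rfl | rfl
    · refine isT_of e 1 0 0 (by simp) _ ?_
      intro x y z h
      have : x = 0 := by simpa using h
      rw [mk6_vec, this]; simp
    · refine isT_of e 0 1 0 (by simp) _ ?_
      intro x y z h
      have : y = 0 := by simpa using h
      rw [mk6_vec, this]; simp
    · refine isT_of e 0 0 1 (by simp) _ ?_
      intro x y z h
      have : z = 0 := by simpa using h
      rw [mk6_vec, this]; simp

variable (F) in
def nn (a b c : K) : ℚ := ∑ x : F, ∑ y : F, if x ≠ 0 ∧ y ≠ 0 ∧ ι x * a + ι y * b + c = 0 then 1 else 0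

def divEquiv (z : F) (hz : z ≠ 0) : F ≃ F where
  toFun x := z / x
  invFun x := z / x
  left_inv x := by
    by_cases hx : x = 0
    · simp [hx]
    · field_simp
  right_inv x := by
    by_cases hx : x = 0
    · simp [hx]
    · field_simp

theorem zn_mk6 (e : B3 F) (a b c : K) (ha : a ≠ 0) (hb : b ≠ 0) (hc : c ≠ 0) :
    zn (mk6 e 0 0 0 a b c) = ((Fintype.card F : ℚ) - 1) * (3 + nn F a b c) := by
  rw [zn, sum_vec e]
  have hcomm : ∀ f : F → F → F → ℚ, ∑ x, ∑ y, ∑ z, f x y z = ∑ z, ∑ x, ∑ y, f x y z := by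
    intro f
    rw [Finset.sum_congr rfl (fun x _ => Finset.sum_comm), Finset.sum_comm]
  have hz : ∀ z : F, ∑ x : F, ∑ y : F, (if vec e x y z ≠ 0 ∧ mk6 e 0 0 0 a b c (vec e x y z) = 0
      then (1 : ℚ) else 0) = (if z = 0 then 2 * ((Fintype.card F : ℚ) - 1) - 1 - nn F a b c else 0)
        + (1 + nn F a b c) := by
    intro z
    simp only [ne_eq, vec_eq_zero, mk6_vec]
    by_cases hz : z = 0
    · have h2 : ∑ x : F, ∑ y : F, ((if x = 0 then (1:ℚ) else 0) + (if y = 0 then (1:ℚ) else 0)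
          - 2 * (if x = 0 then (1:ℚ) else 0) * (if y = 0 then (1:ℚ) else 0)) =
          2 * ((Fintype.card F : ℚ) - 1) := by
        simp [Finset.sum_add_distrib, Finset.sum_sub_distrib, ← Finset.mul_sum]
        ring
      rw [if_pos hz, ← h2, sub_sub, sub_add_cancel]
      refine Finset.sum_congr rfl fun x _ => Finset.sum_congr rfl fun y _ => ?_
      by_cases hx : x = 0 <;> by_cases hy : y = 0 <;> simp [hx, hy, hz, hc]
      norm_num
    · rw [if_neg hz, zero_add, ← Equiv.sum_comp (divEquiv z hz)]
      have h1 : (1 : ℚ) = ∑ x : F, ∑ y : F, (if x = 0 then (1:ℚ) else 0) * (if y = 0 then (1:ℚ) else 0) := by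
        simp
      rw [nn]
      conv_rhs => enter [1]; rw [h1]
      rw [← Finset.sum_add_distrib]
      refine Finset.sum_congr rfl fun x _ => ?_
      rw [← Equiv.sum_comp (divEquiv z hz), ← Finset.sum_add_distrib]
      refine Finset.sum_congr rfl fun y _ => ?_
      change (if ¬ (z / x = 0 ∧ z / y = 0 ∧ z = 0) ∧ ι (z / x) ^ 2 * 0 + ι (z / y) ^ 2 * 0 + ι z ^ 2 * 0
        + ι (z / y) * ι z * a + ι z * ι (z / x) * b + ι (z / x) * ι (z / y) * c = 0 then (1 : ℚ) else 0) = _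
      have hz' : ι z ≠ 0 := by simpa using hz
      by_cases hx : x = 0
      · by_cases hy : y = 0
        · simp [hx, hy, hz]
        · simp [hx, hy, hz, ha]
      · by_cases hy : y = 0
        · simp [hx, hy, hz, hb]
        · have hx' : ι x ≠ 0 := by simpa using hx
          have hy' : ι y ≠ 0 := by simpa using hy
          have : ι (z / x) ^ 2 * 0 + ι (z / y) ^ 2 * 0 + ι z ^ 2 * 0
            + ι (z / y) * ι z * a + ι z * ι (z / x) * b + ι (z / x) * ι (z / y) * c
            = (ι z ^ 2 / (ι x * ι y)) * (ι x * a + ι y * b + c) := by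
            simp only [map_div₀]
            field_simp
            ring
          rw [this]
          simp [hx, hy, hz]
  rw [hcomm]
  simp only [hz]
  rw [Finset.sum_add_distrib]
  simp
  ring

theorem sum_isT (e : B3 F) :
    ∑ Q : QM F K, (if ¬ IsT Q ∧ Q (e 0) = 0 ∧ Q (e 1) = 0 ∧ Q (e 2) = 0 then (zn Q)⁻¹ else 0) =
    ∑ a : K, ∑ b : K, ∑ c : K, if a ≠ 0 ∧ b ≠ 0 ∧ c ≠ 0 then
      (((Fintype.card F : ℚ) - 1) * (3 + nn F a b c))⁻¹ else 0 := by
  rw [sum_QM e]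
  have key : ∀ a1 a2 a3 a b c : K, (if ¬ IsT (mk6 e a1 a2 a3 a b c) ∧ mk6 e a1 a2 a3 a b c (e 0) = 0 ∧
      mk6 e a1 a2 a3 a b c (e 1) = 0 ∧ mk6 e a1 a2 a3 a b c (e 2) = 0
      then (zn (mk6 e a1 a2 a3 a b c))⁻¹ else 0) =
      if a1 = 0 then (if a2 = 0 then (if a3 = 0 then (if a ≠ 0 ∧ b ≠ 0 ∧ c ≠ 0 then
      (((Fintype.card F : ℚ) - 1) * (3 + nn F a b c))⁻¹ else 0) else 0) else 0) else 0 := by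
    intro a1 a2 a3 a b c
    have h1 : mk6 e a1 a2 a3 a b c (e 0) = a1 := by rw [vec_e0 e, mk6_vec]; simp
    have h2 : mk6 e a1 a2 a3 a b c (e 1) = a2 := by rw [vec_e1 e, mk6_vec]; simp
    have h3 : mk6 e a1 a2 a3 a b c (e 2) = a3 := by rw [vec_e2 e, mk6_vec]; simp
    rw [h1, h2, h3]
    by_cases k1 : a1 = 0
    · by_cases k2 : a2 = 0
      · by_cases k3 : a3 = 0
        · subst k1 k2 k3
          simp only [isT_mk6_iff, and_true, if_true]
          by_cases h : a = 0 ∨ b = 0 ∨ c = 0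
          · rw [if_neg (by tauto), if_neg (by tauto)]
          · rw [if_pos h, if_pos (by tauto), zn_mk6 e a b c (by tauto) (by tauto) (by tauto)]
        · simp [k3]
      · simp [k2]
    · simp [k1]
  simp only [key]
  have hI : ∀ (p : Prop) [Decidable p] (f : K → ℚ), ∑ a, (if p then f a else 0) = if p then ∑ a, f a else 0 := by
    intro p _ f; split_ifs <;> simp
  simp only [hI, Finset.sum_ite_eq', Finset.mem_univ, if_true]

variable (F) in
/-- indicator of rank one -/
def rho (a b c : K) : ℚ := ∑ s : F, ∑ t : F, if s ≠ 0 ∧ t ≠ 0 ∧ b = ι s * a ∧ c = ι t * a then 1 else 0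

theorem nn_rho (a b c : K) (ha : a ≠ 0) (hb : b ≠ 0) (hc : c ≠ 0) :
    (rho F a b c = 1 ∧ nn F a b c = (Fintype.card F : ℚ) - 2) ∨
    (rho F a b c = 0 ∧ (nn F a b c = 0 ∨ nn F a b c = 1)) := by
  by_cases h : ∃ s t : F, b = ι s * a ∧ c = ι t * a
  · obtain ⟨s, t, rfl, rfl⟩ := h
    have hs : s ≠ 0 := by rintro rfl; simp at hb
    have ht : t ≠ 0 := by rintro rfl; simp at hc
    left
    constructor
    · rw [rho]
      have : ∀ s' t' : F, (if s' ≠ 0 ∧ t' ≠ 0 ∧ ι s * a = ι s' * a ∧ ι t * a = ι t' * a then (1:ℚ) else 0)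
        = (if s = s' then 1 else 0) * (if t = t' then 1 else 0) := by
        intro s' t'
        simp only [mul_left_inj' ha, (algebraMap F K).injective.eq_iff]
        by_cases h1 : s = s' <;> by_cases h2 : t = t' <;> simp [h1, h2] <;> (subst h1 h2; tauto)
      simp only [this]
      simp
    · rw [nn, Finset.sum_comm]
      have h2 : (Fintype.card F : ℚ) - 2 = ∑ y : F, (1 - (if y = 0 then (1:ℚ) else 0) - (if y = - t / s then 1 else 0)) := by
        simp; ring
      rw [h2]
      refine Finset.sum_congr rfl fun y _ => ?_
      have : ∀ x : F, (if x ≠ 0 ∧ y ≠ 0 ∧ ι x * a + ι y * (ι s * a) + ι t * a = 0 then (1:ℚ) else 0)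
        = if x = -(y * s + t) then (if y ≠ 0 ∧ y * s + t ≠ 0 then 1 else 0) else 0 := by
        intro x
        have e1 : ι x * a + ι y * (ι s * a) + ι t * a = ι (x + y * s + t) * a := by
          simp only [map_add, map_mul]; ring
        have e2 : x + y * s + t = 0 ↔ x = -(y * s + t) := by
          rw [add_assoc, eq_neg_iff_add_eq_zero]
        simp only [e1, mul_eq_zero, ha, or_false, map_eq_zero, e2]
        by_cases hx : x = -(y * s + t)
        · simp only [hx, and_true, if_true, ne_eq, neg_eq_zero]
          congr 1; rw [and_comm]
        · rw [if_neg (by tauto), if_neg hx]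
      simp only [this, Finset.sum_ite_eq', Finset.mem_univ, if_true, Finset.sum_ite_eq]
      have e3 : y * s + t = 0 ↔ y = - t / s := by
        rw [eq_div_iff hs, eq_neg_iff_add_eq_zero]
      simp only [ne_eq, e3]
      by_cases hy : y = 0
      · have : ¬ (0 = - t / s) := by
          rw [eq_div_iff hs]; simp [eq_comm, ht]
        simp [hy, this]
      · by_cases hy2 : y = - t / s <;> simp [hy, hy2]
        exact ⟨ht, hs⟩
  · right
    constructor
    · rw [rho]
      refine Finset.sum_eq_zero fun s _ => Finset.sum_eq_zero fun t _ => ?_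
      rw [if_neg]
      rintro ⟨_, _, h1, h2⟩
      exact h ⟨s, t, h1, h2⟩
    · rw [nn, ← Fintype.sum_prod_type' (f := fun (x y : F) => if x ≠ 0 ∧ y ≠ 0 ∧ ι x * a + ι y * b + c = 0 then (1:ℚ) else 0),
        Finset.sum_boole]
      have : (Finset.univ.filter fun p : F × F => p.1 ≠ 0 ∧ p.2 ≠ 0 ∧ ι p.1 * a + ι p.2 * b + c = 0).card ≤ 1 := by
        rw [Finset.card_le_one]
        rintro ⟨x, y⟩ h1 ⟨x', y'⟩ h2
        simp only [Finset.mem_filter, Finset.mem_univ, true_and] at h1 h2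
        obtain ⟨_, _, h1⟩ := h1
        obtain ⟨_, _, h2⟩ := h2
        by_cases hy : y = y'
        · subst hy
          have : (ι x - ι x') * a = 0 := by linear_combination h1 - h2
          simp only [mul_eq_zero, ha, or_false, sub_eq_zero] at this
          rw [(algebraMap F K).injective this]
        · exfalso; apply h
          have hy' : ι y - ι y' ≠ 0 := by
            rw [← map_sub]; simpa [sub_eq_zero] using hy
          have hb' : b = ι (- (x - x') / (y - y')) * a := by
            simp only [map_div₀, map_neg, map_sub]
            field_simp
            linear_combination h1 - h2
          refine ⟨_, - (x + y * (- (x - x') / (y - y'))), hb', ?_⟩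
          rw [map_neg, map_add, map_mul]
          linear_combination h1 - ι y * hb'
      interval_cases hcard : (Finset.univ.filter fun p : F × F => p.1 ≠ 0 ∧ p.2 ≠ 0 ∧ ι p.1 * a + ι p.2 * b + c = 0).card
      · simp
      · simp


theorem sum_nz {L : Type*} [Field L] [Fintype L] : ∑ s : L, (if s ≠ 0 then (1:ℚ) else 0) = (Fintype.card L : ℚ) - 1 := by
  have : ∀ s : L, (if s ≠ 0 then (1:ℚ) else 0) = 1 - if s = 0 then 1 else 0 := by
    intro s; split_ifs <;> simp_all
  simp only [this]
  simp

theorem sum_rho : ∑ a : K, ∑ b : K, ∑ c : K, (if a ≠ 0 ∧ b ≠ 0 ∧ c ≠ 0 then rho F a b c else 0) =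
    ((Fintype.card K : ℚ) - 1) * ((Fintype.card F : ℚ) - 1) ^ 2 := by
  rw [← sum_nz (L := K), Finset.sum_mul]
  refine Finset.sum_congr rfl fun a _ => ?_
  by_cases ha : a = 0
  · simp [ha]
  have : ∀ b c : K, (if a ≠ 0 ∧ b ≠ 0 ∧ c ≠ 0 then rho F a b c else 0) =
      ∑ s : F, ∑ t : F, ((if s ≠ 0 then 1 else 0) * (if b = ι s * a then 1 else 0)) *
        ((if t ≠ 0 then 1 else 0) * (if c = ι t * a then 1 else 0)) := by
    intro b c
    by_cases h : b ≠ 0 ∧ c ≠ 0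
    · rw [if_pos ⟨ha, h⟩, rho]
      refine Finset.sum_congr rfl fun s _ => Finset.sum_congr rfl fun t _ => ?_
      split_ifs <;> simp_all
    · rw [if_neg (by tauto)]
      symm
      refine Finset.sum_eq_zero fun s _ => Finset.sum_eq_zero fun t _ => ?_
      by_contra hne
      simp only [mul_eq_zero, not_or, ite_eq_right_iff, one_ne_zero, imp_false, not_not] at hne
      apply h
      obtain ⟨⟨h1, h2⟩, h3, h4⟩ := hne
      rw [h2, h4]
      simp [ha, h1, h3]
  simp only [this]
  have e : ∀ f g : F → K → ℚ, ∑ b, ∑ c, ∑ s, ∑ t, f s b * g t c = (∑ s, ∑ b, f s b) * (∑ t, ∑ c, g t c) := by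
    intro f g
    simp only [← Finset.mul_sum, ← Finset.sum_mul]
    rw [Finset.sum_comm (f := f), Finset.sum_comm (f := g)]
  rw [e (fun s b => (if s ≠ 0 then 1 else 0) * (if b = ι s * a then 1 else 0))
    (fun t c => (if t ≠ 0 then 1 else 0) * (if c = ι t * a then 1 else 0))]
  simp only [← Finset.mul_sum, Finset.sum_ite_eq', Finset.sum_ite_eq, Finset.mem_univ, if_true, mul_one, sum_nz]
  simp [ha]
  ring

theorem sum_nn : ∑ a : K, ∑ b : K, ∑ c : K, (if a ≠ 0 ∧ b ≠ 0 ∧ c ≠ 0 then nn F a b c else 0) =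
    ((Fintype.card F : ℚ) - 1) ^ 2 * (((Fintype.card K : ℚ) - 1) * ((Fintype.card K : ℚ) - 2)) := by
  have h1 : ∀ x y : F, x ≠ 0 → y ≠ 0 → ∑ a : K, ∑ b : K, ∑ c : K,
      (if a ≠ 0 ∧ b ≠ 0 ∧ c ≠ 0 ∧ ι x * a + ι y * b + c = 0 then (1:ℚ) else 0) =
      ((Fintype.card K : ℚ) - 1) * ((Fintype.card K : ℚ) - 2) := by
    intro x y hx hy
    have hx' : ι x ≠ 0 := by simpa using hx
    have hy' : ι y ≠ 0 := by simpa using hy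
    rw [← sum_nz (L := K), Finset.sum_mul]
    refine Finset.sum_congr rfl fun a _ => ?_
    by_cases ha : a = 0
    · simp [ha]
    have h2 : ((Fintype.card K : ℚ) - 2) = ∑ b : K, (1 - (if b = 0 then 1 else 0) -
      (if b = - (ι x * a) / ι y then 1 else 0)) := by simp; ring
    rw [if_pos ha, one_mul, h2]
    refine Finset.sum_congr rfl fun b _ => ?_
    have h3 : ∀ c : K, (if a ≠ 0 ∧ b ≠ 0 ∧ c ≠ 0 ∧ ι x * a + ι y * b + c = 0 then (1:ℚ) else 0) =
        if c = -(ι x * a + ι y * b) then (if b ≠ 0 ∧ ι x * a + ι y * b ≠ 0 then 1 else 0) else 0 := by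
      intro c
      have e1 : ι x * a + ι y * b + c = 0 ↔ c = -(ι x * a + ι y * b) := by
        rw [eq_neg_iff_add_eq_zero, add_comm]
      rw [e1]
      by_cases hc : c = -(ι x * a + ι y * b)
      · rw [if_pos hc]
        congr 1
        rw [hc, neg_ne_zero]
        simp [ha]
      · rw [if_neg hc, if_neg (by tauto)]
    simp only [h3, Finset.sum_ite_eq', Finset.sum_ite_eq, Finset.mem_univ, if_true]
    have e3 : ι x * a + ι y * b = 0 ↔ b = - (ι x * a) / ι y := by
      rw [eq_div_iff hy', eq_neg_iff_add_eq_zero, add_comm, mul_comm b]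
    have e4 : ¬ ((0:K) = - (ι x * a) / ι y) := by
      rw [eq_div_iff hy', eq_comm]; simp [hx, ha]
    simp only [ne_eq, e3]
    by_cases hb : b = 0
    · simp only [hb, e4, if_true, if_false]; simp
    · by_cases hb2 : b = - (ι x * a) / ι y
      · rw [if_neg (by tauto), if_neg hb, if_pos hb2]; simp
      · rw [if_pos (by tauto), if_neg hb, if_neg hb2]; simp
  have h2 : ∀ a b c : K, (if a ≠ 0 ∧ b ≠ 0 ∧ c ≠ 0 then nn F a b c else 0) =
      ∑ x : F, ∑ y : F, (if x ≠ 0 ∧ y ≠ 0 then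
        (if a ≠ 0 ∧ b ≠ 0 ∧ c ≠ 0 ∧ ι x * a + ι y * b + c = 0 then (1:ℚ) else 0) else 0) := by
    intro a b c
    split_ifs with h
    · rw [nn]
      refine Finset.sum_congr rfl fun x _ => Finset.sum_congr rfl fun y _ => ?_
      split_ifs <;> simp_all
    · symm
      refine Finset.sum_eq_zero fun s _ => Finset.sum_eq_zero fun t _ => ?_
      split_ifs <;> tauto
  simp only [h2]
  have sw : ∀ f : K → K → K → F → F → ℚ, ∑ a, ∑ b, ∑ c, ∑ x, ∑ y, f a b c x y =
      ∑ x, ∑ y, ∑ a, ∑ b, ∑ c, f a b c x y := by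
    intro f
    have e1 : ∑ a, ∑ b, ∑ c, ∑ x, ∑ y, f a b c x y = ∑ t : K × K × K, ∑ u : F × F, f t.1 t.2.1 t.2.2 u.1 u.2 := by
      simp only [Fintype.sum_prod_type]
    rw [e1, Finset.sum_comm]
    simp only [Fintype.sum_prod_type]
  rw [sw, pow_two, ← sum_nz (L := F), Finset.sum_mul, Finset.sum_mul]
  refine Finset.sum_congr rfl fun x _ => ?_
  rw [mul_assoc, Finset.sum_mul, Finset.mul_sum]
  refine Finset.sum_congr rfl fun y _ => ?_
  by_cases h : x ≠ 0 ∧ y ≠ 0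
  · simp only [h, if_true, ne_eq, not_false_eq_true, and_self, one_mul]
    exact h1 x y h.1 h.2
  · simp only [h, if_false, Finset.sum_const_zero]
    by_cases hx : x = 0
    · simp [hx]
    · have : y = 0 := by tauto
      simp [this]

theorem sum_one : ∑ a : K, ∑ b : K, ∑ c : K, (if a ≠ 0 ∧ b ≠ 0 ∧ c ≠ 0 then (1:ℚ) else 0) =
    ((Fintype.card K : ℚ) - 1) ^ 3 := by
  have : ∀ a b c : K, (if a ≠ 0 ∧ b ≠ 0 ∧ c ≠ 0 then (1:ℚ) else 0) =
    (if a ≠ 0 then 1 else 0) * ((if b ≠ 0 then 1 else 0) * (if c ≠ 0 then 1 else 0)) := by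
    intro a b c; split_ifs <;> simp_all
  simp only [this, ← Finset.mul_sum, ← Finset.sum_mul, sum_nz]
  ring

variable (F K) in
def GG : ℚ := let q : ℚ := Fintype.card F; let Z : ℚ := Fintype.card K
  ((Z - 1) ^ 3 / 3 - 1 / 12 * ((q - 1) ^ 2 * ((Z - 1) * (Z - 2)))
    + (Z - 1) * (q - 1) ^ 2 * (1 / (q + 1) - 1 / 3 + (q - 2) / 12)) / (q - 1)

theorem sum_G : (∑ a : K, ∑ b : K, ∑ c : K, if a ≠ 0 ∧ b ≠ 0 ∧ c ≠ 0 then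
      (((Fintype.card F : ℚ) - 1) * (3 + nn F a b c))⁻¹ else 0) = GG F K := by
  have key : ∀ a b c : K, (if a ≠ 0 ∧ b ≠ 0 ∧ c ≠ 0 then
      (((Fintype.card F : ℚ) - 1) * (3 + nn F a b c))⁻¹ else 0) =
      ((Fintype.card F : ℚ) - 1)⁻¹ * (1 / 3 * (if a ≠ 0 ∧ b ≠ 0 ∧ c ≠ 0 then (1:ℚ) else 0)
        - 1 / 12 * (if a ≠ 0 ∧ b ≠ 0 ∧ c ≠ 0 then nn F a b c else 0)
        + (1 / ((Fintype.card F : ℚ) + 1) - 1 / 3 + ((Fintype.card F : ℚ) - 2) / 12) *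
          (if a ≠ 0 ∧ b ≠ 0 ∧ c ≠ 0 then rho F a b c else 0)) := by
    intro a b c
    split_ifs with h
    · rw [mul_inv]
      congr 1
      rcases nn_rho (F := F) a b c h.1 h.2.1 h.2.2 with ⟨h1, h2⟩ | ⟨h1, h2 | h2⟩
      · rw [h1, h2]
        have : (3 + ((Fintype.card F : ℚ) - 2)) = (Fintype.card F : ℚ) + 1 := by ring
        rw [this]; ring
      · rw [h1, h2]; norm_num
      · rw [h1, h2]; norm_num
    · simp
  simp only [key, ← Finset.mul_sum, Finset.sum_add_distrib, Finset.sum_sub_distrib]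
  rw [sum_one, sum_nn, sum_rho, GG]
  ring

theorem P3 : ∑ Q : QM F K, (if ¬ IsT Q then (zn Q * (zn Q - ((Fintype.card F : ℚ) - 1)) *
      (zn Q - 2 * ((Fintype.card F : ℚ) - 1))) * (zn Q)⁻¹ else 0) =
    ((Fintype.card F : ℚ) ^ 3 - 1) * (((Fintype.card F : ℚ) ^ 3 - (Fintype.card F : ℚ)) *
      (((Fintype.card F : ℚ) ^ 3 - (Fintype.card F : ℚ) ^ 2) * GG F K)) := by
  have key : ∀ Q : QM F K, (if ¬ IsT Q then (zn Q * (zn Q - ((Fintype.card F : ℚ) - 1)) *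
      (zn Q - 2 * ((Fintype.card F : ℚ) - 1))) * (zn Q)⁻¹ else 0) =
      ∑ v : V3 F, ∑ w : V3 F, ∑ u : V3 F,
      if v ≠ 0 ∧ w ∉ Submodule.span F {v} ∧ u ∉ Submodule.span F {v, w} then
        (if ¬ IsT Q ∧ Q v = 0 ∧ Q w = 0 ∧ Q u = 0 then (zn Q)⁻¹ else 0) else 0 := by
    intro Q
    by_cases hT : IsT Q
    · simp [hT]
    · rw [if_pos hT, triple Q hT, Finset.sum_mul]
      refine Finset.sum_congr rfl fun v _ => ?_
      rw [Finset.sum_mul]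
      refine Finset.sum_congr rfl fun w _ => ?_
      rw [Finset.sum_mul]
      refine Finset.sum_congr rfl fun u _ => ?_
      simp only [hT, not_false_eq_true, true_and]
      split_ifs <;> simp
  simp only [key]
  have sw : ∀ f : QM F K → V3 F → V3 F → V3 F → ℚ, ∑ Q, ∑ v, ∑ w, ∑ u, f Q v w u =
      ∑ v, ∑ w, ∑ u, ∑ Q, f Q v w u := by
    intro f
    have e1 : ∑ Q, ∑ v, ∑ w, ∑ u, f Q v w u = ∑ Q, ∑ t : V3 F × V3 F × V3 F, f Q t.1 t.2.1 t.2.2 := by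
      simp only [Fintype.sum_prod_type]
    rw [e1, Finset.sum_comm]
    simp only [Fintype.sum_prod_type]
  rw [sw, ← sum_ne_zero, Finset.sum_mul]
  refine Finset.sum_congr rfl fun v _ => ?_
  by_cases hv : v = 0
  · simp [hv]
  have e1 := sum_notMem _ (finrank_span1 v hv)
  rw [pow_one] at e1
  rw [if_pos hv, one_mul, ← e1, Finset.sum_mul]
  refine Finset.sum_congr rfl fun w _ => ?_
  by_cases hw : w ∈ Submodule.span F {v}
  · simp [hw]
  have e2 := sum_notMem _ (finrank_span2 v w hv hw)
  rw [if_pos hw, one_mul, ← e2, Finset.sum_mul]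
  refine Finset.sum_congr rfl fun u _ => ?_
  by_cases hu : u ∈ Submodule.span F {v, w}
  · simp [hu]
  rw [if_pos hu, one_mul, ← sum_G]
  obtain ⟨e, rfl, rfl, rfl⟩ := exists_basis v w u hv hw hu
  rw [← sum_isT e]
  refine Finset.sum_congr rfl fun Q _ => ?_
  rw [if_pos ⟨hv, hw, hu⟩]


variable (F) in
def rr (a b c : K) : ℚ := ∑ x : F, ∑ y : F, if ι x * a + ι y * b + c = 0 then 1 else 0

def Van (l : V3 F →ₗ[F] F) (Q : QM F K) : Prop := l ≠ 0 ∧ ∀ v, l v = 0 → Q v = 0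

/-- number of linear forms on whose kernel `Q` vanishes -/
def ww (Q : QM F K) : ℚ := ∑ l : V3 F →ₗ[F] F, if Van l Q then 1 else 0

def dl (e : B3 F) (x y z : F) : V3 F →ₗ[F] F := x • e.coord 0 + y • e.coord 1 + z • e.coord 2

theorem dl_vec (e : B3 F) (l1 l2 l3 x y z : F) :
    dl e l1 l2 l3 (vec e x y z) = l1 * x + l2 * y + l3 * z := by
  simp only [dl, LinearMap.add_apply, LinearMap.smul_apply, coord_vec0, coord_vec1, coord_vec2, smul_eq_mul]

theorem sum_dl (e : B3 F) (f : (V3 F →ₗ[F] F) → ℚ) : ∑ l, f l = ∑ x, ∑ y, ∑ z, f (dl e x y z) := by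
  have : ∑ x, ∑ y, ∑ z, f (dl e x y z) = ∑ t : F × F × F, f (dl e t.1 t.2.1 t.2.2) := by
    simp only [Fintype.sum_prod_type]
  rw [this]
  symm
  refine Fintype.sum_bijective (fun t : F × F × F => dl e t.1 t.2.1 t.2.2) ⟨?_, ?_⟩ _ _ (fun _ => rfl)
  · rintro ⟨x, y, z⟩ ⟨x', y', z'⟩ h
    have H : ∀ a b c : F, dl e x y z (vec e a b c) = dl e x' y' z' (vec e a b c) :=
      fun a b c => congrArg (fun l => l (vec e a b c)) h
    simp only [dl_vec] at H
    have h1 := H 1 0 0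
    have h2 := H 0 1 0
    have h3 := H 0 0 1
    simp at h1 h2 h3
    subst h1 h2 h3; rfl
  · intro l
    refine ⟨(l (e 0), l (e 1), l (e 2)), ?_⟩
    refine LinearMap.ext fun v => ?_
    rw [← vec_coord e v, dl_vec]
    simp only [vec, map_add, map_smul, smul_eq_mul]
    ring

theorem sum_dual_ne : ∑ l : V3 F →ₗ[F] F, (if l ≠ 0 then (1:ℚ) else 0) = (Fintype.card F : ℚ) ^ 3 - 1 := by
  have h : ∀ l : V3 F →ₗ[F] F, (if l ≠ 0 then (1:ℚ) else 0) = 1 - if l = 0 then 1 else 0 := by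
    intro l; split_ifs <;> simp_all
  have h1 : ∑ l : V3 F →ₗ[F] F, (1:ℚ) = (Fintype.card F : ℚ) ^ 3 := by
    rw [sum_dl (Pi.basisFun F (Fin 3))]
    simp; ring
  simp only [h, Finset.sum_sub_distrib, h1]
  simp

theorem zn_mkT (e : B3 F) (a b c : K) :
    zn (mk6 e 0 0 c b a 0) = (Fintype.card F : ℚ) ^ 2 - 1 + ((Fintype.card F : ℚ) - 1) * rr F a b c := by
  rw [zn, sum_vec e]
  have hcomm : ∀ f : F → F → F → ℚ, ∑ x, ∑ y, ∑ z, f x y z = ∑ z, ∑ x, ∑ y, f x y z := by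
    intro f
    rw [Finset.sum_congr rfl (fun x _ => Finset.sum_comm), Finset.sum_comm]
  have hz : ∀ z : F, ∑ x : F, ∑ y : F, (if vec e x y z ≠ 0 ∧ mk6 e 0 0 c b a 0 (vec e x y z) = 0
      then (1 : ℚ) else 0) = (if z = 0 then (Fintype.card F : ℚ) ^ 2 - 1 - rr F a b c else 0)
        + rr F a b c := by
    intro z
    simp only [ne_eq, vec_eq_zero, mk6_vec]
    by_cases hz : z = 0
    · have h2 : ∑ x : F, ∑ y : F, (1 - (if x = 0 then (1:ℚ) else 0) * (if y = 0 then (1:ℚ) else 0)) =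
          (Fintype.card F : ℚ) ^ 2 - 1 := by
        simp [Finset.sum_sub_distrib]
        ring
      rw [if_pos hz, ← h2, sub_add_cancel]
      refine Finset.sum_congr rfl fun x _ => Finset.sum_congr rfl fun y _ => ?_
      by_cases hx : x = 0 <;> by_cases hy : y = 0 <;> simp [hx, hy, hz]
    · rw [if_neg hz, zero_add, ← Equiv.sum_comp (Equiv.mulLeft₀ z hz), rr]
      refine Finset.sum_congr rfl fun x _ => ?_
      rw [← Equiv.sum_comp (Equiv.mulLeft₀ z hz)]
      refine Finset.sum_congr rfl fun y _ => ?_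
      have hz' : ι z ≠ 0 := by simpa using hz
      simp only [Equiv.mulLeft₀_apply, map_mul]
      have : (ι z * ι x) ^ 2 * 0 + (ι z * ι y) ^ 2 * 0 + ι z ^ 2 * c + ι z * ι y * ι z * b +
        ι z * (ι z * ι x) * a + ι z * ι x * (ι z * ι y) * 0 = ι z ^ 2 * (ι x * a + ι y * b + c) := by ring
      rw [this]
      simp [hz]
  rw [hcomm]
  simp only [hz]
  rw [Finset.sum_add_distrib]
  simp
  ring

theorem van_dl (e : B3 F) (a b c : K) (l1 l2 l3 : F) (h : l1 ≠ 0 ∨ l2 ≠ 0)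
    (hv : Van (dl e l1 l2 l3) (mk6 e 0 0 c b a 0)) : ∃ k : K, a = k * ι l1 ∧ b = k * ι l2 ∧ c = k * ι l3 := by
  have H : ∀ x y z : F, l1 * x + l2 * y + l3 * z = 0 → ι z ^ 2 * c + ι y * ι z * b + ι z * ι x * a = 0 := by
    intro x y z h0
    have := hv.2 (vec e x y z) (by rw [dl_vec, h0])
    rw [mk6_vec] at this
    simpa using this
  by_cases h1 : l1 = 0
  · have h2 : l2 ≠ 0 := by tauto
    have h2' : ι l2 ≠ 0 := by simpa using h2
    have e1 := H 0 (-l3 / l2) 1 (by field_simp; ring)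
    have e2 := H 1 (-l3 / l2) 1 (by rw [h1]; field_simp; ring)
    simp only [map_zero, map_one, map_div₀, map_neg] at e1 e2
    have ha : a = 0 := by linear_combination e2 - e1
    refine ⟨b / ι l2, by simp [h1, ha], by field_simp, ?_⟩
    field_simp at e1 ⊢
    linear_combination e1
  · have h1' : ι l1 ≠ 0 := by simpa using h1
    have e1 := H (-l3 / l1) 0 1 (by field_simp; ring)
    have e2 := H (-(l2 + l3) / l1) 1 1 (by field_simp; ring)
    simp only [map_zero, map_one, map_div₀, map_neg, map_add] at e1 e2
    refine ⟨a / ι l1, by field_simp, ?_, ?_⟩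
    · field_simp at e1 e2 ⊢
      linear_combination e2 - e1
    · field_simp at e1 ⊢
      linear_combination e1

theorem van_triv (e : B3 F) (a b c : K) (l3 : F) (h : l3 ≠ 0) : Van (dl e 0 0 l3) (mk6 e 0 0 c b a 0) := by
  constructor
  · intro h0
    have := congrArg (fun l => l (vec e 0 0 1)) h0
    simp [dl_vec] at this
    exact h this
  · intro v
    rw [← vec_coord e v, dl_vec, mk6_vec]
    intro h0
    have : e.coord 2 v = 0 := by
      simpa only [zero_mul, zero_add, mul_eq_zero, h, false_or] using h0
    rw [this]; simp

theorem not_van_zero (e : B3 F) (Q : QM F K) : ¬ Van (dl e 0 0 0) Q := by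
  intro h; apply h.1; simp [dl]

theorem van_prop (e : B3 F) (k : K) (m1 m2 m3 s : F) (hs : s ≠ 0) (hm : m1 ≠ 0 ∨ m2 ≠ 0) :
    Van (dl e (s * m1) (s * m2) (s * m3)) (mk6 e 0 0 (k * ι m3) (k * ι m2) (k * ι m1) 0) := by
  constructor
  · intro h0
    have h1 := congrArg (fun l => l (vec e 1 0 0)) h0
    have h2 := congrArg (fun l => l (vec e 0 1 0)) h0
    simp [dl_vec, hs] at h1 h2
    tauto
  · intro v
    rw [← vec_coord e v, dl_vec, mk6_vec]
    generalize e.coord 0 v = x; generalize e.coord 1 v = y; generalize e.coord 2 v = z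
    intro h0
    have h1 : m1 * x + m2 * y + m3 * z = 0 := by
      have : s * (m1 * x + m2 * y + m3 * z) = 0 := by linear_combination h0
      simpa [hs] using this
    have h2 := congrArg (fun t => ι t) h1
    simp only [map_add, map_mul, map_zero] at h2
    linear_combination ι z * k * h2

theorem rr_ww (e : B3 F) (a b c : K) (hne : ¬ (a = 0 ∧ b = 0 ∧ c = 0)) :
    ((rr F a b c = 0 ∨ rr F a b c = 1) ∧ ww (mk6 e 0 0 c b a 0) = (Fintype.card F : ℚ) - 1) ∨
    (rr F a b c = (Fintype.card F : ℚ) ∧ ww (mk6 e 0 0 c b a 0) = 2 * ((Fintype.card F : ℚ) - 1)) := by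
  have hd : ∑ x : F, ∑ y : F, ∑ z : F, (if x = 0 then (1:ℚ) else 0) * ((if y = 0 then 1 else 0) *
      (if z ≠ 0 then 1 else 0)) = (Fintype.card F : ℚ) - 1 := by
    simp only [← Finset.mul_sum, ← Finset.sum_mul, sum_nz]
    simp
  by_cases hA : ∃ (k : K) (m1 m2 m3 : F), (m1 ≠ 0 ∨ m2 ≠ 0) ∧ a = k * ι m1 ∧ b = k * ι m2 ∧ c = k * ι m3
  · right
    obtain ⟨k, m1, m2, m3, hm, rfl, rfl, rfl⟩ := hA
    have hk : k ≠ 0 := by rintro rfl; simp at hne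
    constructor
    · have e0 : ∀ x y : F, ι x * (k * ι m1) + ι y * (k * ι m2) + k * ι m3 = 0 ↔ x * m1 + y * m2 + m3 = 0 := by
        intro x y
        have : ι x * (k * ι m1) + ι y * (k * ι m2) + k * ι m3 = k * ι (x * m1 + y * m2 + m3) := by
          simp only [map_add, map_mul]; ring
        rw [this]; simp only [mul_eq_zero, hk, false_or, map_eq_zero]
      rw [rr]
      simp only [e0]
      by_cases h1 : m1 = 0
      · have h2 : m2 ≠ 0 := by tauto
        have : ∀ x y : F, x * m1 + y * m2 + m3 = 0 ↔ y = - m3 / m2 := by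
          intro x y
          rw [eq_div_iff h2, h1, eq_neg_iff_add_eq_zero]; simp
        simp [this]
      · rw [Finset.sum_comm]
        have : ∀ x y : F, x * m1 + y * m2 + m3 = 0 ↔ x = - (y * m2 + m3) / m1 := by
          intro x y
          rw [eq_div_iff h1, eq_neg_iff_add_eq_zero, add_assoc]
        simp only [this]
        simp
    · have hs : ∑ x : F, ∑ y : F, ∑ z : F, ∑ s : F, (if s ≠ 0 ∧ x = s * m1 ∧ y = s * m2 ∧ z = s * m3
          then (1:ℚ) else 0) = (Fintype.card F : ℚ) - 1 := by
        have e1 : ∑ x : F, ∑ y : F, ∑ z : F, ∑ s : F, (if s ≠ 0 ∧ x = s * m1 ∧ y = s * m2 ∧ z = s * m3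
          then (1:ℚ) else 0) = ∑ t : F × F × F, ∑ s : F, (if s ≠ 0 ∧ t.1 = s * m1 ∧ t.2.1 = s * m2 ∧ t.2.2 = s * m3
          then (1:ℚ) else 0) := by simp only [Fintype.sum_prod_type]
        rw [e1, Finset.sum_comm, ← sum_nz (L := F)]
        refine Finset.sum_congr rfl fun s _ => ?_
        have : ∀ t : F × F × F, (if s ≠ 0 ∧ t.1 = s * m1 ∧ t.2.1 = s * m2 ∧ t.2.2 = s * m3
          then (1:ℚ) else 0) = if t = (s * m1, s * m2, s * m3) then (if s ≠ 0 then 1 else 0) else 0 := by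
          rintro ⟨x, y, z⟩
          simp only [Prod.mk.injEq]
          split_ifs <;> tauto
        simp only [this, Finset.sum_ite_eq', Finset.sum_ite_eq, Finset.mem_univ, if_true]
      rw [ww, sum_dl e, two_mul]
      nth_rewrite 1 [← hd]
      rw [← hs]
      simp only [← Finset.sum_add_distrib]
      refine Finset.sum_congr rfl fun x _ => Finset.sum_congr rfl fun y _ => Finset.sum_congr rfl fun z _ => ?_
      by_cases hxy : x = 0 ∧ y = 0
      · obtain ⟨rfl, rfl⟩ := hxy
        have h0 : ∑ s : F, (if s ≠ 0 ∧ 0 = s * m1 ∧ 0 = s * m2 ∧ z = s * m3 then (1:ℚ) else 0) = 0 := by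
          refine Finset.sum_eq_zero fun s _ => ?_
          rw [if_neg]
          rintro ⟨h1, h2, h3, _⟩
          simp [h1] at h2 h3
          tauto
        rw [h0]
        by_cases hz : z = 0
        · rw [hz, if_neg (not_van_zero e _)]; simp
        · rw [if_pos (van_triv e _ _ _ z hz)]; simp [hz]
      · have h00 : (if x = 0 then (1:ℚ) else 0) * ((if y = 0 then 1 else 0) * (if z ≠ 0 then 1 else 0)) = 0 := by
          by_cases hx : x = 0
          · have : y ≠ 0 := by tauto
            simp [this]
          · simp [hx]
        rw [h00, zero_add]
        have hxy' : x ≠ 0 ∨ y ≠ 0 := by tauto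
        by_cases hV : Van (dl e x y z) (mk6 e 0 0 (k * ι m3) (k * ι m2) (k * ι m1) 0)
        · rw [if_pos hV]
          obtain ⟨k', h1, h2, h3⟩ := van_dl e _ _ _ x y z hxy' hV
          have hk' : k' ≠ 0 := by
            rintro rfl
            simp [hk] at h1 h2
            tauto
          obtain ⟨s, hs0, hs1, hs2, hs3⟩ : ∃ s : F, s ≠ 0 ∧ x = s * m1 ∧ y = s * m2 ∧ z = s * m3 := by
            have inj : ∀ u v : F, k * k' * ι u = k * k' * ι v → u = v := by
              intro u v h
              exact (algebraMap F K).injective (mul_left_cancel₀ (mul_ne_zero hk hk') h)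
            by_cases hx : x = 0
            · have hy : y ≠ 0 := by tauto
              have hm1 : m1 = 0 := by rw [hx] at h1; simpa [hk] using h1
              have hm2 : m2 ≠ 0 := by tauto
              refine ⟨y / m2, div_ne_zero hy hm2, by simp [hx, hm1], by field_simp, ?_⟩
              field_simp
              apply inj
              rw [map_mul, map_mul]
              linear_combination (-k * ι m2) * h3 + k * ι m3 * h2
            · have hm1 : m1 ≠ 0 := by
                rintro rfl
                simp [hk', hx] at h1
              refine ⟨x / m1, div_ne_zero hx hm1, by field_simp, ?_, ?_⟩
              · field_simp
                apply inj
                rw [map_mul, map_mul]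
                linear_combination (-k * ι m1) * h2 + k * ι m2 * h1
              · field_simp
                apply inj
                rw [map_mul, map_mul]
                linear_combination (-k * ι m1) * h3 + k * ι m3 * h1
          symm
          rw [Finset.sum_eq_single s]
          · rw [if_pos ⟨hs0, hs1, hs2, hs3⟩]
          · intro t _ hts
            rw [if_neg]
            rintro ⟨_, t1, t2, _⟩
            apply hts
            rcases hm with hm | hm
            · exact mul_right_cancel₀ hm (t1.symm.trans hs1)
            · exact mul_right_cancel₀ hm (t2.symm.trans hs2)
          · simp
        · rw [if_neg hV]
          symm
          refine Finset.sum_eq_zero fun s _ => ?_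
          rw [if_neg]
          rintro ⟨h1, rfl, rfl, rfl⟩
          exact hV (van_prop e k m1 m2 m3 s h1 hm)
  · left
    constructor
    · rw [rr, ← Fintype.sum_prod_type' (f := fun (x y : F) => if ι x * a + ι y * b + c = 0 then (1:ℚ) else 0),
        Finset.sum_boole]
      have : (Finset.univ.filter fun p : F × F => ι p.1 * a + ι p.2 * b + c = 0).card ≤ 1 := by
        rw [Finset.card_le_one]
        rintro ⟨x, y⟩ h1 ⟨x', y'⟩ h2
        simp only [Finset.mem_filter, Finset.mem_univ, true_and] at h1 h2
        by_contra hne2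
        apply hA
        by_cases hy : y = y'
        · have hx : x' - x ≠ 0 := by
            intro h0; apply hne2; rw [hy, sub_eq_zero.1 h0]
          have hx' : ι x' - ι x ≠ 0 := by rw [← map_sub]; exact (map_ne_zero ι).2 hx
          subst hy
          have ha : a = 0 := by
            have : (ι x' - ι x) * a = 0 := by linear_combination h2 - h1
            simpa [hx'] using this
          refine ⟨b / (ι x' - ι x), 0, x' - x, -((x' - x) * y), Or.inr hx, by simp [ha], ?_, ?_⟩
          · rw [map_sub]; field_simp
          · rw [map_neg, map_mul, map_sub]; field_simp
            rw [ha] at h1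
            linear_combination h1
        · have hy0 : y - y' ≠ 0 := sub_ne_zero.2 hy
          have hy' : ι y - ι y' ≠ 0 := by rw [← map_sub]; exact (map_ne_zero ι).2 hy0
          refine ⟨a / (ι y - ι y'), y - y', x' - x, -((y - y') * x + (x' - x) * y), Or.inl hy0, ?_, ?_, ?_⟩
          · rw [map_sub]; field_simp
          · rw [map_sub]; field_simp
            linear_combination h1 - h2
          · simp only [map_neg, map_mul, map_sub, map_add]; field_simp
            linear_combination ι y * h2 - ι y' * h1
      interval_cases hcard : (Finset.univ.filter fun p : F × F => ι p.1 * a + ι p.2 * b + c = 0).card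
      · simp
      · simp
    · rw [ww, sum_dl e, ← hd]
      refine Finset.sum_congr rfl fun x _ => Finset.sum_congr rfl fun y _ => Finset.sum_congr rfl fun z _ => ?_
      by_cases hxy : x = 0 ∧ y = 0
      · obtain ⟨rfl, rfl⟩ := hxy
        by_cases hz : z = 0
        · rw [hz, if_neg (not_van_zero e _)]; simp
        · rw [if_pos (van_triv e _ _ _ z hz)]; simp [hz]
      · have h00 : (if x = 0 then (1:ℚ) else 0) * ((if y = 0 then 1 else 0) * (if z ≠ 0 then 1 else 0)) = 0 := by
          by_cases hx : x = 0
          · have : y ≠ 0 := by tauto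
            simp [this]
          · simp [hx]
        rw [h00, if_neg]
        intro hV
        have hxy' : x ≠ 0 ∨ y ≠ 0 := by tauto
        obtain ⟨k', h1, h2, h3⟩ := van_dl e _ _ _ x y z hxy' hV
        exact hA ⟨k', x, y, z, hxy', h1, h2, h3⟩


theorem swap5 (f : K → K → K → F → F → ℚ) : ∑ a, ∑ b, ∑ c, ∑ x, ∑ y, f a b c x y =
      ∑ x, ∑ y, ∑ a, ∑ b, ∑ c, f a b c x y := by
  have e1 : ∑ a, ∑ b, ∑ c, ∑ x, ∑ y, f a b c x y = ∑ t : K × K × K, ∑ u : F × F, f t.1 t.2.1 t.2.2 u.1 u.2 := by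
    simp only [Fintype.sum_prod_type]
  rw [e1, Finset.sum_comm]
  simp only [Fintype.sum_prod_type]

theorem sum_rr : ∑ a : K, ∑ b : K, ∑ c : K, rr F a b c =
    (Fintype.card F : ℚ) ^ 2 * (Fintype.card K : ℚ) ^ 2 := by
  simp only [rr]
  rw [swap5]
  have : ∀ (x y : F) (a b c : K), ι x * a + ι y * b + c = 0 ↔ c = -(ι x * a + ι y * b) := by
    intro x y a b c
    rw [eq_neg_iff_add_eq_zero, add_comm]
  simp only [this, Finset.sum_ite_eq', Finset.mem_univ, if_true]
  simp
  ring

theorem sum_pair (x y x' y' : F) : ∑ a : K, ∑ b : K, ∑ c : K,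
    (if ι x * a + ι y * b + c = 0 then (1:ℚ) else 0) * (if ι x' * a + ι y' * b + c = 0 then 1 else 0) =
    (Fintype.card K : ℚ) + if x = x' then (if y = y' then (Fintype.card K : ℚ) ^ 2 - Fintype.card K else 0) else 0 := by
  have h1 : ∀ a b c : K, (if ι x * a + ι y * b + c = 0 then (1:ℚ) else 0) *
      (if ι x' * a + ι y' * b + c = 0 then 1 else 0) =
      if c = -(ι x * a + ι y * b) then (if ι (x - x') * a + ι (y - y') * b = 0 then 1 else 0) else 0 := by
    intro a b c
    have e1 : ι x * a + ι y * b + c = 0 ↔ c = -(ι x * a + ι y * b) := by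
      rw [eq_neg_iff_add_eq_zero, add_comm]
    rw [e1]
    by_cases hc : c = -(ι x * a + ι y * b)
    · rw [if_pos hc, if_pos hc, one_mul]
      congr 1
      rw [hc, map_sub, map_sub]
      apply propext
      constructor <;> intro h <;> linear_combination -h
    · rw [if_neg hc, if_neg hc, zero_mul]
  simp only [h1, Finset.sum_ite_eq', Finset.mem_univ, if_true]
  by_cases hx : x = x'
  · by_cases hy : y = y'
    · simp [hx, hy]; ring
    · have : y - y' ≠ 0 := sub_ne_zero.2 hy
      simp [hx, hy, this, -map_sub]
  · have h0 : ι (x - x') ≠ 0 := (map_ne_zero ι).2 (sub_ne_zero.2 hx)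
    rw [Finset.sum_comm]
    have : ∀ a b : K, ι (x - x') * a + ι (y - y') * b = 0 ↔ a = - (ι (y - y') * b) / ι (x - x') := by
      intro a b
      rw [eq_div_iff h0, eq_neg_iff_add_eq_zero, mul_comm a]
    simp only [this, Finset.sum_ite_eq', Finset.mem_univ, if_true]
    simp [hx]

theorem sum_rr2 : ∑ a : K, ∑ b : K, ∑ c : K, rr F a b c * rr F a b c =
    (Fintype.card F : ℚ) ^ 4 * (Fintype.card K : ℚ) +
      (Fintype.card F : ℚ) ^ 2 * ((Fintype.card K : ℚ) ^ 2 - Fintype.card K) := by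
  have h : ∀ a b c : K, rr F a b c * rr F a b c = ∑ x : F, ∑ y : F, ∑ x' : F, ∑ y' : F,
      (if ι x * a + ι y * b + c = 0 then (1:ℚ) else 0) * (if ι x' * a + ι y' * b + c = 0 then 1 else 0) := by
    intro a b c
    conv_lhs => enter [1]; rw [rr]
    rw [Finset.sum_mul]
    refine Finset.sum_congr rfl fun x _ => ?_
    rw [Finset.sum_mul]
    refine Finset.sum_congr rfl fun y _ => ?_
    rw [rr, Finset.mul_sum]
    refine Finset.sum_congr rfl fun x' _ => ?_
    rw [Finset.mul_sum]
  simp only [h]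
  rw [swap5 (fun a b c x y => ∑ x' : F, ∑ y' : F, (if ι x * a + ι y * b + c = 0 then (1:ℚ) else 0) *
    (if ι x' * a + ι y' * b + c = 0 then 1 else 0))]
  have h2 : ∀ x y : F, ∑ a : K, ∑ b : K, ∑ c : K, ∑ x' : F, ∑ y' : F,
      (if ι x * a + ι y * b + c = 0 then (1:ℚ) else 0) * (if ι x' * a + ι y' * b + c = 0 then 1 else 0)
      = (Fintype.card F : ℚ) ^ 2 * (Fintype.card K : ℚ) + ((Fintype.card K : ℚ) ^ 2 - Fintype.card K) := by
    intro x y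
    rw [swap5]
    simp only [sum_pair, Finset.sum_add_distrib]
    have hI : ∀ (p : Prop) [Decidable p] (f : F → ℚ), ∑ a, (if p then f a else 0) = if p then ∑ a, f a else 0 := by
      intro p _ f; split_ifs <;> simp
    simp only [hI, Finset.sum_ite_eq, Finset.mem_univ, if_true]
    simp
    ring
  simp only [h2]
  simp
  ring

theorem van_coord (e : B3 F) (l : V3 F →ₗ[F] F) (hl : l ≠ 0) (he : ∀ x y z, l (vec e x y z) = z)
    (a1 a2 a3 a4 a5 a6 : K) : Van l (mk6 e a1 a2 a3 a4 a5 a6) ↔ a1 = 0 ∧ a2 = 0 ∧ a6 = 0 := by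
  constructor
  · intro h
    have h1 := h.2 (vec e 1 0 0) (he _ _ _)
    have h2 := h.2 (vec e 0 1 0) (he _ _ _)
    have h3 := h.2 (vec e 1 1 0) (he _ _ _)
    rw [mk6_vec] at h1 h2 h3
    simp at h1 h2 h3
    simpa [h1, h2] using h3
  · rintro ⟨rfl, rfl, rfl⟩
    refine ⟨hl, fun v => ?_⟩
    rw [← vec_coord e v, he, mk6_vec]
    intro h
    rw [h]; simp

theorem mkT_eq_zero (e : B3 F) (a b c : K) : mk6 e 0 0 c b a 0 = 0 ↔ a = 0 ∧ b = 0 ∧ c = 0 := by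
  constructor
  · intro h
    have H : ∀ x y z : F, mk6 e 0 0 c b a 0 (vec e x y z) = 0 := by intro x y z; rw [h]; rfl
    simp only [mk6_vec] at H
    have h1 := H 0 0 1
    have h2 := H 0 1 1
    have h3 := H 1 0 1
    simp at h1
    simp [h1] at h2 h3
    exact ⟨h3, h2, h1⟩
  · rintro ⟨rfl, rfl, rfl⟩
    ext v
    rw [← vec_coord e v, mk6_vec]
    simp

/-- the weight attached to forms vanishing on a plane -/
def phi (Q : QM F K) : ℚ := 1 - zn Q / ((Fintype.card F : ℚ) - 1) +
  zn Q * (zn Q - ((Fintype.card F : ℚ) - 1)) / (2 * ((Fintype.card F : ℚ) - 1) ^ 2)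

variable (F K) in
def HH : ℚ := let q : ℚ := Fintype.card F; let Z : ℚ := Fintype.card K
  (q - 1)⁻¹ * (q * (q - 1) / 2 * (Z ^ 3 - 1) + q * (q ^ 2 * Z ^ 2 - q ^ 2)
    - q / (2 * (q - 1)) * (q ^ 2 * (q ^ 2 - 1) * Z - q ^ 2 * (q ^ 2 - 1)))

theorem cardF_sub_ne : ((Fintype.card F : ℚ) - 1) ≠ 0 := by
  have : 1 < Fintype.card F := Fintype.one_lt_card
  have : (1:ℚ) < Fintype.card F := by exact_mod_cast this
  linarith

theorem phi_ww (e : B3 F) (a b c : K) (hne : ¬ (a = 0 ∧ b = 0 ∧ c = 0)) :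
    phi (mk6 e 0 0 c b a 0) / ww (mk6 e 0 0 c b a 0) =
    ((Fintype.card F : ℚ) - 1)⁻¹ * ((Fintype.card F : ℚ) * ((Fintype.card F : ℚ) - 1) / 2 +
      (Fintype.card F : ℚ) * rr F a b c - (Fintype.card F : ℚ) / (2 * ((Fintype.card F : ℚ) - 1)) *
        (rr F a b c * rr F a b c - rr F a b c)) := by
  have hd := cardF_sub_ne (F := F)
  have hz := zn_mkT e a b c
  rw [phi, hz]
  rcases rr_ww e a b c hne with ⟨h1 | h1, h2⟩ | ⟨h1, h2⟩ <;> rw [h1, h2] <;>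
    generalize (Fintype.card F : ℚ) = q at * <;> field_simp <;> ring

theorem sum_van (l : V3 F →ₗ[F] F) (hl : l ≠ 0) :
    ∑ Q : QM F K, (if Van l Q ∧ Q ≠ 0 then phi Q / ww Q else 0) = HH F K := by
  obtain ⟨e, he⟩ := exists_basis_dual l hl
  have hd := cardF_sub_ne (F := F)
  rw [sum_QM e]
  have key : ∀ a1 a2 c b a a6 : K, (if Van l (mk6 e a1 a2 c b a a6) ∧ mk6 e a1 a2 c b a a6 ≠ 0 then
      phi (mk6 e a1 a2 c b a a6) / ww (mk6 e a1 a2 c b a a6) else 0) =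
      if a1 = 0 then (if a2 = 0 then (if a6 = 0 then
      ((Fintype.card F : ℚ) - 1)⁻¹ * ((Fintype.card F : ℚ) * ((Fintype.card F : ℚ) - 1) / 2 +
      (Fintype.card F : ℚ) * rr F a b c - (Fintype.card F : ℚ) / (2 * ((Fintype.card F : ℚ) - 1)) *
        (rr F a b c * rr F a b c - rr F a b c)
        - (if a = 0 then 1 else 0) * (if b = 0 then 1 else 0) * (if c = 0 then 1 else 0) *
        ((Fintype.card F : ℚ) * ((Fintype.card F : ℚ) - 1) / 2 +
      (Fintype.card F : ℚ) * (Fintype.card F : ℚ) ^ 2 - (Fintype.card F : ℚ) / (2 * ((Fintype.card F : ℚ) - 1)) *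
        ((Fintype.card F : ℚ) ^ 2 * (Fintype.card F : ℚ) ^ 2 - (Fintype.card F : ℚ) ^ 2))) else 0) else 0) else 0 := by
    intro a1 a2 c b a a6
    rw [van_coord e l hl he]
    by_cases k1 : a1 = 0
    · by_cases k2 : a2 = 0
      · by_cases k3 : a6 = 0
        · subst k1 k2 k3
          simp only [ne_eq, mkT_eq_zero, true_and, and_self, if_true]
          by_cases h : a = 0 ∧ b = 0 ∧ c = 0
          · rw [if_neg (by tauto)]
            obtain ⟨rfl, rfl, rfl⟩ := h
            have : rr F (0:K) 0 0 = (Fintype.card F : ℚ) ^ 2 := by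
              simp [rr]; ring
            rw [this]; simp
          · rw [if_pos h, phi_ww e a b c h]
            have : (if a = 0 then (1:ℚ) else 0) * (if b = 0 then 1 else 0) * (if c = 0 then 1 else 0) = 0 := by
              split_ifs <;> simp_all
            rw [this]; ring
        · simp [k3]
      · simp [k2]
    · simp [k1]
  simp only [key]
  have hI : ∀ (p : Prop) [Decidable p] (f : K → ℚ), ∑ a, (if p then f a else 0) = if p then ∑ a, f a else 0 := by
    intro p _ f; split_ifs <;> simp
  simp only [hI, Finset.sum_ite_eq', Finset.mem_univ, if_true]
  have hsw : ∀ f : K → K → K → ℚ, ∑ c, ∑ b, ∑ a, f a b c = ∑ a, ∑ b, ∑ c, f a b c := by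
    intro f
    rw [Finset.sum_comm, Finset.sum_congr rfl (fun x _ => Finset.sum_comm), Finset.sum_comm]
  rw [hsw]
  simp only [← Finset.mul_sum, Finset.sum_add_distrib, Finset.sum_sub_distrib, ← Finset.sum_mul]
  rw [sum_rr, sum_rr2, HH]
  congr 1
  simp
  generalize (Fintype.card F : ℚ) = q at *
  field_simp
  ring

theorem isT_iff_ww (Q : QM F K) : IsT Q ↔ ww Q ≠ 0 := by
  rw [ww, Finset.sum_boole]
  simp only [ne_eq, Nat.cast_eq_zero, Finset.card_eq_zero, Finset.filter_eq_empty_iff, Finset.mem_univ, true_implies,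
    not_forall, not_not]
  rfl

theorem zn_zero : zn (0 : QM F K) = (Fintype.card F : ℚ) ^ 3 - 1 := by
  rw [← sum_ne_zero, zn]; simp

theorem isT_zero : IsT (0 : QM F K) :=
  isT_of (Pi.basisFun F (Fin 3)) 1 0 0 (by simp) _ (by simp)

theorem PT : ∑ Q : QM F K, (if IsT Q then phi Q else 0) =
    phi (0 : QM F K) + ((Fintype.card F : ℚ) ^ 3 - 1) * HH F K := by
  have h1 : ∀ Q : QM F K, (if IsT Q then phi Q else 0) = (if Q = 0 then phi (0 : QM F K) else 0) +
      ∑ l : V3 F →ₗ[F] F, (if Van l Q ∧ Q ≠ 0 then phi Q / ww Q else 0) := by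
    intro Q
    by_cases hQ : Q = 0
    · simp [hQ, isT_zero]
    · have h2 : ∑ l : V3 F →ₗ[F] F, (if Van l Q ∧ Q ≠ 0 then phi Q / ww Q else 0) = ww Q * (phi Q / ww Q) := by
        conv_rhs => enter [1]; rw [ww]
        rw [Finset.sum_mul]
        refine Finset.sum_congr rfl fun l _ => ?_
        split_ifs <;> simp_all
      rw [h2, if_neg hQ, zero_add]
      split_ifs with hT
      · have := (isT_iff_ww Q).1 hT
        field_simp
      · have : ww Q = 0 := by
          by_contra h; exact hT ((isT_iff_ww Q).2 h)
        rw [this, zero_mul]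
  simp only [h1]
  rw [Finset.sum_add_distrib, Finset.sum_comm]
  congr 1
  · simp
  · rw [← sum_dual_ne, Finset.sum_mul]
    refine Finset.sum_congr rfl fun l _ => ?_
    by_cases hl : l = 0
    · rw [if_neg (by simpa using hl), zero_mul]
      refine Finset.sum_eq_zero fun Q _ => ?_
      rw [if_neg]
      rintro ⟨h, _⟩
      exact h.1 hl
    · rw [if_pos hl, one_mul]
      exact sum_van l hl

theorem zn_eq_zero (Q : QM F K) : zn Q = 0 ↔ ∀ v, v ≠ 0 → Q v ≠ 0 := by
  rw [zn, Finset.sum_boole]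
  simp [Finset.filter_eq_empty_iff]

theorem zn_ne_of_T (Q : QM F K) (h : IsT Q) : zn Q ≠ 0 := by
  obtain ⟨l, hl, H⟩ := h
  obtain ⟨e, he⟩ := exists_basis_dual l hl
  intro h0
  exact (zn_eq_zero Q).1 h0 (vec e 1 0 0) (by rw [ne_eq, vec_eq_zero]; simp) (H _ (he _ _ _))

theorem count_zn : ∑ Q : QM F K, (if zn Q = 0 then (1:ℚ) else 0) =
    ((Fintype.card K : ℚ) - 1) * ((Fintype.card K : ℚ) - (Fintype.card F : ℚ)) *
        (24 * (Fintype.card K : ℚ) ^ 4 - 24 * (Fintype.card F : ℚ) ^ 2 * (Fintype.card K : ℚ) ^ 3 +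
          (12 * (Fintype.card F : ℚ) ^ 4 - 12 * (Fintype.card F : ℚ)) * (Fintype.card K : ℚ) ^ 2 -
          (4 * (Fintype.card F : ℚ) ^ 6 - 4 * (Fintype.card F : ℚ) ^ 5 + 8 * (Fintype.card F : ℚ) ^ 4 - 20 * (Fintype.card F : ℚ) ^ 3 + 12 * (Fintype.card F : ℚ) ^ 2) *
            (Fintype.card K : ℚ) +
          ((Fintype.card F : ℚ) ^ 8 - 4 * (Fintype.card F : ℚ) ^ 7 + 11 * (Fintype.card F : ℚ) ^ 6 - 17 * (Fintype.card F : ℚ) ^ 5 + 12 * (Fintype.card F : ℚ) ^ 4 - 3 * (Fintype.card F : ℚ) ^ 3)) / 24 := by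
  have hd := cardF_sub_ne (F := F)
  have key : ∀ Q : QM F K, (if zn Q = 0 then (1:ℚ) else 0) =
      1 - ((Fintype.card F : ℚ) - 1)⁻¹ * zn Q + (2 * ((Fintype.card F : ℚ) - 1) ^ 2)⁻¹ *
        (zn Q * (zn Q - ((Fintype.card F : ℚ) - 1)))
      - (if IsT Q then phi Q else 0)
      - (2 * ((Fintype.card F : ℚ) - 1) ^ 2)⁻¹ *
      (if ¬ IsT Q then (zn Q * (zn Q - ((Fintype.card F : ℚ) - 1)) *
      (zn Q - 2 * ((Fintype.card F : ℚ) - 1))) * (zn Q)⁻¹ else 0) := by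
    intro Q
    by_cases hT : IsT Q
    · rw [if_neg (zn_ne_of_T Q hT), if_pos hT, if_neg (by simpa using hT), phi]
      ring
    · rw [if_neg hT, if_pos hT]
      by_cases h0 : zn Q = 0
      · simp [h0]
      · rw [if_neg h0]
        generalize (Fintype.card F : ℚ) = q at *
        generalize zn Q = n at *
        field_simp
        ring
  simp only [key, Finset.sum_add_distrib, Finset.sum_sub_distrib, ← Finset.mul_sum]
  rw [S1, S2, PT, P3, phi, zn_zero, HH, GG, sum_QM (Pi.basisFun F (Fin 3))]
  have hq1 : ((Fintype.card F : ℚ) + 1) ≠ 0 := by positivity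
  simp
  generalize (Fintype.card F : ℚ) = q at *
  generalize (Fintype.card K : ℚ) = Z at *
  field_simp
  ring


theorem lin_form (f : MvPolynomial (Fin 3) K) (hf : f ∈ MvPolynomial.homogeneousSubmodule (Fin 3) K 1) :
    ∃ c0 c1 c2 : K, ∀ v : V3 F, MvPolynomial.aeval (fun i => ι (v i)) f =
      c0 * ι (v 0) + c1 * ι (v 1) + c2 * ι (v 2) := by
  rw [MvPolynomial.homogeneousSubmodule_one_eq_span_X] at hf
  induction hf using Submodule.span_induction with
  | mem x hx =>
    obtain ⟨i, rfl⟩ := hx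
    fin_cases i
    · exact ⟨1, 0, 0, fun v => by simp⟩
    · exact ⟨0, 1, 0, fun v => by simp⟩
    · exact ⟨0, 0, 1, fun v => by simp⟩
  | zero => exact ⟨0, 0, 0, fun v => by simp⟩
  | add x y _ _ hx hy =>
    obtain ⟨a, b, c, h⟩ := hx
    obtain ⟨a', b', c', h'⟩ := hy
    exact ⟨a + a', b + b', c + c', fun v => by rw [map_add, h, h']; ring⟩
  | smul r x _ hx =>
    obtain ⟨a, b, c, h⟩ := hx
    exact ⟨r * a, r * b, r * c, fun v => by rw [map_smul, h, smul_eq_mul]; ring⟩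

theorem mk6_std (a1 a2 a3 a4 a5 a6 : K) (v : V3 F) :
    mk6 (Pi.basisFun F (Fin 3)) a1 a2 a3 a4 a5 a6 v = ι (v 0) ^ 2 * a1 + ι (v 1) ^ 2 * a2 + ι (v 2) ^ 2 * a3
      + ι (v 1) * ι (v 2) * a4 + ι (v 2) * ι (v 0) * a5 + ι (v 0) * ι (v 1) * a6 := by
  conv_lhs => rw [← vec_coord (Pi.basisFun F (Fin 3)) v]
  rw [mk6_vec]
  simp

theorem quad_form (f : MvPolynomial (Fin 3) K) (hf : f ∈ MvPolynomial.homogeneousSubmodule (Fin 3) K 2) :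
    ∃ Q : QM F K, ∀ v : V3 F, MvPolynomial.aeval (fun i => ι (v i)) f = Q v := by
  rw [← MvPolynomial.homogeneousSubmodule_one_pow, pow_two] at hf
  induction hf using Submodule.mul_induction_on' with
  | mem_mul_mem m hm n hn =>
    obtain ⟨a, b, c, h⟩ := lin_form (F := F) m hm
    obtain ⟨a', b', c', h'⟩ := lin_form (F := F) n hn
    refine ⟨mk6 (Pi.basisFun F (Fin 3)) (a * a') (b * b') (c * c') (b * c' + c * b') (c * a' + a * c')
      (a * b' + b * a'), fun v => ?_⟩
    rw [map_mul, h, h', mk6_std]; ring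
  | add x _ y _ hx hy =>
    obtain ⟨Q, h⟩ := hx
    obtain ⟨Q', h'⟩ := hy
    exact ⟨Q + Q', fun v => by rw [map_add, h, h']; rfl⟩

theorem quad_poly (Q : QM F K) : ∃ f ∈ MvPolynomial.homogeneousSubmodule (Fin 3) K 2,
    ∀ v : V3 F, MvPolynomial.aeval (fun i => ι (v i)) f = Q v := by
  rw [eq_mk6 (Pi.basisFun F (Fin 3)) Q]
  generalize Q (Pi.basisFun F (Fin 3) 0) = a1
  generalize Q (Pi.basisFun F (Fin 3) 1) = a2
  generalize Q (Pi.basisFun F (Fin 3) 2) = a3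
  generalize QuadraticMap.polar Q (Pi.basisFun F (Fin 3) 1) (Pi.basisFun F (Fin 3) 2) = a4
  generalize QuadraticMap.polar Q (Pi.basisFun F (Fin 3) 2) (Pi.basisFun F (Fin 3) 0) = a5
  generalize QuadraticMap.polar Q (Pi.basisFun F (Fin 3) 0) (Pi.basisFun F (Fin 3) 1) = a6
  have hX : ∀ i j : Fin 3, (X i * X j : MvPolynomial (Fin 3) K) ∈ MvPolynomial.homogeneousSubmodule (Fin 3) K 2 :=
    fun i j => (MvPolynomial.isHomogeneous_X K i).mul (MvPolynomial.isHomogeneous_X K j)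
  refine ⟨a1 • (X 0 * X 0) + a2 • (X 1 * X 1) + a3 • (X 2 * X 2) + a4 • (X 1 * X 2) + a5 • (X 2 * X 0)
    + a6 • (X 0 * X 1), ?_, fun v => ?_⟩
  · exact add_mem (add_mem (add_mem (add_mem (add_mem (Submodule.smul_mem _ _ (hX _ _))
      (Submodule.smul_mem _ _ (hX _ _))) (Submodule.smul_mem _ _ (hX _ _))) (Submodule.smul_mem _ _ (hX _ _)))
      (Submodule.smul_mem _ _ (hX _ _))) (Submodule.smul_mem _ _ (hX _ _))
  · rw [mk6_std]
    simp only [map_add, map_smul, map_mul, aeval_X, smul_eq_mul]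
    ring

theorem mem_code (rep : Plane F → (Fin 3 → F)) (g : Plane F → K) :
    g ∈ VeroneseCodeExt K rep ↔ ∃ Q : QM F K, g = fun p => Q (rep p) := by
  rw [VeroneseCodeExt, Submodule.mem_map]
  constructor
  · rintro ⟨f, hf, hg⟩
    obtain ⟨Q, hQ⟩ := quad_form (F := F) f hf
    refine ⟨Q, ?_⟩
    rw [← hg]
    funext p
    rw [LinearMap.pi_apply, AlgHom.toLinearMap_apply]
    exact hQ (rep p)
  · rintro ⟨Q, hg⟩
    obtain ⟨f, hf, hQ⟩ := quad_poly Q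
    refine ⟨f, hf, ?_⟩
    rw [hg]
    funext p
    rw [LinearMap.pi_apply, AlgHom.toLinearMap_apply]
    exact hQ (rep p)

theorem exists_rep (rep : Plane F → (Fin 3 → F))
    (hrep : ∀ p : Plane F, ∃ h : rep p ≠ 0, Projectivization.mk F (rep p) h = p) (v : V3 F) (hv : v ≠ 0) :
    ∃ (p : Plane F) (c : F), c ≠ 0 ∧ v = c • rep p := by
  obtain ⟨h, h'⟩ := hrep (Projectivization.mk F v hv)
  rw [Projectivization.mk_eq_mk_iff] at h'
  obtain ⟨a, ha⟩ := h'
  refine ⟨Projectivization.mk F v hv, (a⁻¹ : Fˣ), Units.ne_zero _, ?_⟩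
  rw [← ha]
  change v = a⁻¹ • a • v
  rw [inv_smul_smul]

theorem wt_full (g : Plane F → K) :
    wt g = Fintype.card F ^ 2 + Fintype.card F + 1 ↔ ∀ p, g p ≠ 0 := by
  have hc : Nat.card (Plane F) = Fintype.card F ^ 2 + Fintype.card F + 1 := by
    rw [Projectivization.card_of_finrank F (Fin 3 → F) (n := 3) (by simp)]
    simp [Finset.sum_range_succ]
    ring
  have : Finite (Plane F) := Nat.finite_of_card_ne_zero (by rw [hc]; omega)
  rw [← hc, wt, Nat.card_coe_set_eq, ← Set.ncard_univ]
  constructor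
  · intro h p
    have := Set.eq_of_subset_of_ncard_le (Set.subset_univ _) h.ge
    have hp : p ∈ {p | g p ≠ 0} := by rw [this]; trivial
    exact hp
  · intro h
    congr 1
    ext p; simp [h]

theorem card_code (rep : Plane F → (Fin 3 → F))
    (hrep : ∀ p : Plane F, ∃ h : rep p ≠ 0, Projectivization.mk F (rep p) h = p) :
    (Nat.card {g : Plane F → K | g ∈ VeroneseCodeExt K rep ∧ wt g = Fintype.card F ^ 2 + Fintype.card F + 1} : ℚ) =
      ∑ Q : QM F K, (if zn Q = 0 then (1:ℚ) else 0) := by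
  have hfull : ∀ Q : QM F K, zn Q = 0 ↔ ∀ p, Q (rep p) ≠ 0 := by
    intro Q
    rw [zn_eq_zero]
    constructor
    · intro h p; exact h _ (hrep p).1
    · intro h v hv
      obtain ⟨p, c, hc, rfl⟩ := exists_rep rep hrep v hv
      rw [QuadraticMap.map_smul]
      exact smul_ne_zero (mul_ne_zero hc hc) (h p)
  have hinj : Function.Injective (fun (Q : QM F K) (p : Plane F) => Q (rep p)) := by
    intro Q Q' h
    ext v
    by_cases hv : v = 0
    · simp [hv]
    · obtain ⟨p, c, hc, rfl⟩ := exists_rep rep hrep v hv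
      rw [QuadraticMap.map_smul, QuadraticMap.map_smul]
      congr 1
      exact congrFun h p
  have hset : {g : Plane F → K | g ∈ VeroneseCodeExt K rep ∧ wt g = Fintype.card F ^ 2 + Fintype.card F + 1} =
      (fun (Q : QM F K) (p : Plane F) => Q (rep p)) '' {Q | zn Q = 0} := by
    ext g
    simp only [Set.mem_ofPred_eq, mem_code, wt_full, Set.mem_image, hfull]
    constructor
    · rintro ⟨⟨Q, rfl⟩, h⟩; exact ⟨Q, h, rfl⟩
    · rintro ⟨Q, h, rfl⟩; exact ⟨⟨Q, rfl⟩, h⟩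
  rw [hset, Nat.card_image_of_injective hinj, Finset.sum_boole]
  congr 1
  rw [Nat.card_eq_fintype_card, Fintype.card_subtype]
  simp

end Ver

theorem veronese_ext_count_full_support
    {F : Type*} [Field F] [Fintype F] (q : ℕ) (hq : Fintype.card F = q) (hq4 : 4 ≤ q)
    (rep : Plane F → (Fin 3 → F))
    (hrep : ∀ p : Plane F, ∃ h : rep p ≠ 0, Projectivization.mk F (rep p) h = p)
    (K : Type*) [Field K] [Fintype K] [Algebra F K] :
    (Nat.card {g : Plane F → K | g ∈ VeroneseCodeExt K rep ∧ wt g = q ^ 2 + q + 1} : ℚ) =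
      ((Fintype.card K : ℚ) - 1) * ((Fintype.card K : ℚ) - q) *
        (24 * (Fintype.card K : ℚ) ^ 4 - 24 * (q : ℚ) ^ 2 * (Fintype.card K : ℚ) ^ 3 +
          (12 * (q : ℚ) ^ 4 - 12 * q) * (Fintype.card K : ℚ) ^ 2 -
          (4 * (q : ℚ) ^ 6 - 4 * q ^ 5 + 8 * q ^ 4 - 20 * q ^ 3 + 12 * q ^ 2) *
            (Fintype.card K : ℚ) +
          ((q : ℚ) ^ 8 - 4 * q ^ 7 + 11 * q ^ 6 - 17 * q ^ 5 + 12 * q ^ 4 - 3 * q ^ 3)) / 24 := by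
  subst hq
  rw [Ver.card_code rep hrep]
  exact Ver.count_zn
end
end

section
/- Let q ≥ 4 be a prime power and let K be a finite field extension of F. Then every nonzero codeword g of the extended Veronese code C_q(K) has weight wt(g) belonging to the set {q^2−q, q^2−1, q^2, q^2+q−3, q^2+q−2, q^2+q−1, q^2+q, q^2+q+1}; that is, the only weights for which the generalized weight polynomial of C_q is nonzero are 0 and these eight values. -/
noncomputable section

open MvPolynomial

lemma count_hyp {F : Type*} [Field F] [Fintype F] [DecidableEq F] (k : F) :
    Fintype.card {t : F × F // t.1 * t.2 = k} =
      if k = 0 then 2 * Fintype.card F - 1 else Fintype.card F - 1 := by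
  have h1 : Fintype.card {t : F × F // t.1 * t.2 = k} =
      ∑ u : F, (Finset.univ.filter fun v : F => u * v = k).card := by
    rw [Fintype.card_subtype, Finset.card_filter, Fintype.sum_prod_type]
    simp only [Finset.card_filter]
  have h2 : ∀ u ∈ Finset.univ.erase (0:F), (Finset.univ.filter fun v : F => u * v = k).card = 1 := by
    intro u hu
    have hu : u ≠ 0 := by simpa using hu
    rw [Finset.card_eq_one]
    refine ⟨u⁻¹ * k, ?_⟩
    ext v
    simp only [Finset.mem_filter, Finset.mem_univ, true_and, Finset.mem_singleton]
    constructor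
    · rintro rfl; field_simp
    · rintro rfl; field_simp
  rw [h1, ← Finset.add_sum_erase _ _ (Finset.mem_univ (0:F)), Finset.sum_congr rfl h2]
  have := Fintype.card_pos (α := F)
  simp only [Finset.sum_const, smul_eq_mul, mul_one, Finset.card_erase_of_mem (Finset.mem_univ _),
    Finset.card_univ, zero_mul]
  split_ifs with hk
  · simp [hk]; omega
  · simp [Ne.symm hk]

lemma card_prod_sub {A B : Type*} [Fintype A] [Finite B] (P : A → B → Prop) :
    Nat.card {t : A × B // P t.1 t.2} = ∑ a, Nat.card {b // P a b} := by
  classical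
  have := Fintype.ofFinite B
  rw [← Nat.card_sigma]
  exact Nat.card_congr ⟨fun t => ⟨t.1.1, t.1.2, t.2⟩, fun t => ⟨(t.1, t.2.1), t.2.2⟩,
    fun _ => rfl, fun _ => rfl⟩

/-- Count in the nondegenerate case. -/
lemma count_B {F : Type*} [Field F] [Fintype F] (β γ : F) (hβ : β ≠ 0) (hγ : γ ≠ 0) :
    Nat.card {t : F × F × F // t.2.1 * t.2.2 + β * (t.1 * t.2.2) + γ * (t.1 * t.2.1) = 0} =
      Fintype.card F ^ 2 := by
  classical
  rw [card_prod_sub (fun (a : F) (b : F × F) => b.1 * b.2 + β * (a * b.2) + γ * (a * b.1) = 0)]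
  have h : ∀ a : F, Nat.card {b : F × F // b.1 * b.2 + β * (a * b.2) + γ * (a * b.1) = 0}
      = if a = 0 then 2 * Fintype.card F - 1 else Fintype.card F - 1 := by
    intro a
    have := count_hyp (β * γ * a ^ 2)
    rw [← Nat.card_eq_fintype_card] at this
    have h3 : (β * γ * a ^ 2 = 0) ↔ a = 0 := by simp [hβ, hγ]
    simp only [h3] at this
    rw [← this]
    refine Nat.card_congr (Equiv.subtypeEquiv
      ((Equiv.addRight (β * a)).prodCongr (Equiv.addRight (γ * a))) ?_)
    rintro ⟨u, v⟩
    simp only [Equiv.prodCongr_apply, Prod.map, Equiv.coe_addRight]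
    constructor
    · intro h; linear_combination h
    · intro h; linear_combination h
  simp only [h]
  rw [← Finset.add_sum_erase _ _ (Finset.mem_univ (0:F)), Finset.sum_congr rfl
    (g := fun _ => Fintype.card F - 1) (by intro x hx; simp at hx; simp [hx])]
  have := Fintype.card_pos (α := F)
  obtain ⟨n, hn⟩ : ∃ n, Fintype.card F = n + 1 := ⟨_, (Nat.succ_pred_eq_of_pos this).symm⟩
  simp [Finset.card_erase_of_mem, hn]
  ring_nf
  have : 2 + n * 2 - 1 = 1 + 2 * n := by omega
  rw [this]; ring

lemma count_aff {F K : Type*} [Field F] [Fintype F] [AddCommGroup K] [Module F K] (A B C : K) :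
    let m := Nat.card {t : F × F // A + t.1 • B + t.2 • C = 0}
    m = 0 ∨ m = 1 ∨ m = Fintype.card F ∨ (A = 0 ∧ B = 0 ∧ C = 0) := by
  intro m
  by_cases hne : Nonempty {t : F × F // A + t.1 • B + t.2 • C = 0}
  swap
  · left
    have := not_nonempty_iff.mp hne
    exact Nat.card_of_isEmpty
  obtain ⟨⟨t0, ht0⟩⟩ := hne
  let φ : F × F →ₗ[F] K := (LinearMap.toSpanSingleton F K B).coprod (LinearMap.toSpanSingleton F K C)
  have hφ : ∀ t : F × F, φ t = t.1 • B + t.2 • C := fun t => by simp [φ]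
  have hm : m = Nat.card (LinearMap.ker φ) := by
    refine Nat.card_congr (Equiv.subtypeEquiv (Equiv.subRight t0) ?_)
    intro t
    rw [Equiv.subRight_apply, LinearMap.mem_ker, map_sub, hφ, hφ, sub_eq_zero]
    rw [add_assoc] at ht0 ⊢
    rw [← ht0]; simp
  have hk := Module.natCard_eq_pow_finrank (K := F) (V := LinearMap.ker φ)
  have hle : Module.finrank F (LinearMap.ker φ) ≤ 2 := by
    have := Submodule.finrank_le (LinearMap.ker φ)
    simpa using this
  rw [← hm, Nat.card_eq_fintype_card] at hk
  interval_cases hd : Module.finrank F (LinearMap.ker φ)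
  · simp [hk]
  · simp [hk]
  · right; right; right
    have htop : LinearMap.ker φ = ⊤ := Submodule.eq_top_of_finrank_eq (by simp [hd])
    have hall : ∀ t, φ t = 0 := fun t => by
      have : t ∈ LinearMap.ker φ := by rw [htop]; trivial
      simpa using this
    have hB := hall (1,0)
    have hC := hall (0,1)
    simp [hφ] at hB hC
    subst hB hC
    simpa using ht0

lemma count_A {F K : Type*} [Field F] [Fintype F] [AddCommGroup K] [Module F K] (A B C : K) :
    Nat.card {t : F × F × F // (t.1 * t.1) • A + (t.1 * t.2.1) • B + (t.1 * t.2.2) • C = 0} =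
      Fintype.card F ^ 2 + (Fintype.card F - 1) *
        Nat.card {t : F × F // A + t.1 • B + t.2 • C = 0} := by
  classical
  rw [card_prod_sub (fun (a : F) (b : F × F) =>
    (a * a) • A + (a * b.1) • B + (a * b.2) • C = 0)]
  have h : ∀ a ∈ Finset.univ.erase (0 : F),
      Nat.card {b : F × F // (a * a) • A + (a * b.1) • B + (a * b.2) • C = 0}
      = Nat.card {t : F × F // A + t.1 • B + t.2 • C = 0} := by
    intro a ha
    have ha : a ≠ 0 := by simpa using ha
    symm
    refine Nat.card_congr (Equiv.subtypeEquiv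
      ((Equiv.mulLeft₀ a ha).prodCongr (Equiv.mulLeft₀ a ha)) ?_)
    rintro ⟨u, v⟩
    simp only [Equiv.prodCongr_apply, Prod.map, Equiv.mulLeft₀_apply]
    have : (a * a) • A + (a * (a * u)) • B + (a * (a * v)) • C = (a * a) • (A + u • B + v • C) := by
      module
    rw [this, smul_eq_zero]
    simp [ha]
  rw [← Finset.add_sum_erase _ _ (Finset.mem_univ (0:F)), Finset.sum_congr rfl h]
  simp [Finset.card_erase_of_mem, sq]

lemma Q_expand {F K V : Type*} [Field F] [AddCommGroup K] [Module F K] [AddCommGroup V] [Module F V]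
    (Q : QuadraticMap F V K) (x y z : F) (u v w : V) :
    Q (x • u + y • v + z • w) = (x * x) • Q u + (y * y) • Q v + (z * z) • Q w +
      (x * y) • QuadraticMap.polar Q u v + (x * z) • QuadraticMap.polar Q u w +
      (y * z) • QuadraticMap.polar Q v w := by
  rw [QuadraticMap.map_add Q (x • u + y • v), QuadraticMap.map_add Q (x • u)]
  simp only [Q.map_smul, QuadraticMap.polar_add_left, QuadraticMap.polar_smul_left, QuadraticMap.polar_smul_right]
  module

lemma bij_of_li {F : Type*} [Field F] (u v w : Fin 3 → F) (h : LinearIndependent F ![u, v, w]) :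
    Function.Bijective (fun t : F × F × F => t.1 • u + t.2.1 • v + t.2.2 • w) := by
  let b := basisOfLinearIndependentOfCardEqFinrank h (by simp)
  let e : F × F × F ≃ (Fin 3 → F) := ⟨fun t => ![t.1, t.2.1, t.2.2], fun x => (x 0, x 1, x 2),
    fun t => by simp, fun x => by ext i; fin_cases i <;> simp⟩
  have := (e.trans b.equivFun.symm.toEquiv).bijective
  convert this using 2 with t
  simp [b, e, Module.Basis.equivFun_symm_apply, Fin.sum_univ_three]

lemma card_zero_coord {F K : Type*} [Field F] [AddCommGroup K] [Module F K]
    (Q : QuadraticMap F (Fin 3 → F) K) (u v w : Fin 3 → F) (h : LinearIndependent F ![u, v, w]) :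
    Nat.card {x // Q x = 0} =
    Nat.card {t : F × F × F // Q (t.1 • u + t.2.1 • v + t.2.2 • w) = 0} :=
  (Nat.card_congr (Equiv.subtypeEquiv (Equiv.ofBijective _ (bij_of_li u v w h))
    (fun t => by simp))).symm

/-- Q vanishes on a plane. -/
lemma case_A {F K : Type*} [Field F] [Fintype F] [AddCommGroup K] [Module F K]
    (Q : QuadraticMap F (Fin 3 → F) K) (hQ : ∃ x, Q x ≠ 0)
    (v w : Fin 3 → F) (h : LinearIndependent F ![v, w]) (hv : Q v = 0) (hw : Q w = 0)
    (hvw : QuadraticMap.polar Q v w = 0) :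
    ∃ m, (m = 0 ∨ m = 1 ∨ m = Fintype.card F) ∧
      Nat.card {x // Q x = 0} = Fintype.card F ^ 2 + (Fintype.card F - 1) * m := by
  obtain ⟨u, hu⟩ : ∃ u, u ∉ Submodule.span F (Set.range ![v, w]) := by
    by_contra! hcon
    have htop : Submodule.span F (Set.range ![v, w]) = ⊤ := by
      rw [eq_top_iff]; intro x _; exact hcon x
    have h1 := finrank_span_eq_card h
    rw [htop] at h1
    simp at h1
  have hli : LinearIndependent F ![u, v, w] := linearIndependent_finCons.mpr ⟨h, hu⟩
  have hexp : ∀ t : F × F × F, Q (t.1 • u + t.2.1 • v + t.2.2 • w) =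
      (t.1 * t.1) • Q u + (t.1 * t.2.1) • QuadraticMap.polar Q u v +
       (t.1 * t.2.2) • QuadraticMap.polar Q u w := by
    intro t; rw [Q_expand, hv, hw, hvw]; module
  have hc := card_zero_coord Q u v w hli
  simp only [hexp] at hc
  rw [count_A] at hc
  refine ⟨_, ?_, hc⟩
  rcases count_aff (F := F) (Q u) (QuadraticMap.polar Q u v) (QuadraticMap.polar Q u w) with h | h | h | ⟨h1, h2, h3⟩
  · exact Or.inl h
  · exact Or.inr (Or.inl h)
  · exact Or.inr (Or.inr h)
  · exfalso
    obtain ⟨x, hx⟩ := hQ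
    obtain ⟨t, rfl⟩ := (bij_of_li u v w hli).2 x
    apply hx
    simp only [hexp, h1, h2, h3]; simp

/-- Five zeros, no plane. -/
lemma case_B {F K : Type*} [Field F] [Fintype F] [AddCommGroup K] [Module F K]
    (Q : QuadraticMap F (Fin 3 → F) K)
    (hno : ∀ v w, LinearIndependent F ![v, w] → Q v = 0 → Q w = 0 → QuadraticMap.polar Q v w ≠ 0)
    (p : Fin 5 → Fin 3 → F) (hp : ∀ i, Q (p i) = 0)
    (hli : ∀ i j, i ≠ j → LinearIndependent F ![p i, p j]) :
    Nat.card {x // Q x = 0} = Fintype.card F ^ 2 := by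
  have hnp : ∀ i j, i ≠ j → ∀ s : F, s • p i ≠ p j := by
    intro i j hij s hs
    have := LinearIndependent.pair_iff.mp (hli i j hij) s (-1) (by simp [hs])
    simp at this
  have h3 : LinearIndependent F ![p 0, p 1, p 2] := by
    refine linearIndependent_finCons.mpr ⟨hli 1 2 (by decide), ?_⟩
    intro hmem
    simp only [Matrix.range_cons, Matrix.range_empty, Set.union_empty, Set.singleton_union] at hmem
    obtain ⟨s, t, hst⟩ := Submodule.mem_span_pair.mp hmem
    have h0 := Q_expand Q 0 s t 0 (p 1) (p 2)
    simp only [hp, hst, zero_smul, zero_add, smul_zero, zero_mul] at h0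
    rcases smul_eq_zero.mp h0.symm with h | h
    · rcases mul_eq_zero.mp h with h | h
      · exact hnp 2 0 (by decide) t (by simpa [h] using hst)
      · exact hnp 1 0 (by decide) s (by simpa [h] using hst)
    · exact hno _ _ (hli 1 2 (by decide)) (hp _) (hp _) h
  set c := QuadraticMap.polar Q (p 0) (p 1) with hc
  set b := QuadraticMap.polar Q (p 0) (p 2) with hb
  set a := QuadraticMap.polar Q (p 1) (p 2) with ha
  have hc0 : c ≠ 0 := hno _ _ (hli 0 1 (by decide)) (hp _) (hp _)
  have hb0 : b ≠ 0 := hno _ _ (hli 0 2 (by decide)) (hp _) (hp _)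
  have ha0 : a ≠ 0 := hno _ _ (hli 1 2 (by decide)) (hp _) (hp _)
  have hexp : ∀ t : F × F × F, Q (t.1 • p 0 + t.2.1 • p 1 + t.2.2 • p 2) =
      (t.2.1 * t.2.2) • a + (t.1 * t.2.2) • b + (t.1 * t.2.1) • c := by
    intro t; rw [Q_expand, hp, hp, hp]; module
  have hbij := bij_of_li _ _ _ h3
  obtain ⟨⟨x0, x1, x2⟩, hx⟩ := hbij.2 (p 3)
  obtain ⟨⟨y0, y1, y2⟩, hy⟩ := hbij.2 (p 4)
  have hex := hexp (x0, x1, x2)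
  have hey := hexp (y0, y1, y2)
  simp only at hx hy hex hey
  rw [hx, hp] at hex
  rw [hy, hp] at hey
  -- all coordinates nonzero
  have hnz : ∀ (j : Fin 5), 3 ≤ j → ∀ z0 z1 z2 : F, z0 • p 0 + z1 • p 1 + z2 • p 2 = p j →
      0 = (z1 * z2) • a + (z0 * z2) • b + (z0 * z1) • c → z0 ≠ 0 ∧ z1 ≠ 0 ∧ z2 ≠ 0 := by
    intro j hj z0 z1 z2 hz he
    have n0 : 0 ≠ j := by rintro rfl; revert hj; decide
    have n1 : 1 ≠ j := by rintro rfl; revert hj; decide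
    have n2 : 2 ≠ j := by rintro rfl; revert hj; decide
    refine ⟨?_, ?_, ?_⟩
    · rintro rfl
      simp only [zero_mul, zero_smul, add_zero, zero_add] at he hz
      rcases mul_eq_zero.mp ((smul_eq_zero.mp he.symm).resolve_right ha0) with rfl | rfl
      · exact hnp 2 j n2 z2 (by simpa using hz)
      · exact hnp 1 j n1 z1 (by simpa using hz)
    · rintro rfl
      simp only [zero_mul, mul_zero, zero_smul, add_zero, zero_add] at he hz
      rcases mul_eq_zero.mp ((smul_eq_zero.mp he.symm).resolve_right hb0) with rfl | rfl
      · exact hnp 2 j n2 z2 (by simpa using hz)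
      · exact hnp 0 j n0 z0 (by simpa using hz)
    · rintro rfl
      simp only [zero_mul, mul_zero, zero_smul, add_zero, zero_add] at he hz
      rcases mul_eq_zero.mp ((smul_eq_zero.mp he.symm).resolve_right hc0) with rfl | rfl
      · exact hnp 1 j n1 z1 (by simpa using hz)
      · exact hnp 0 j n0 z0 (by simpa using hz)
  obtain ⟨hx0, hx1, hx2⟩ := hnz 3 (by decide) x0 x1 x2 hx hex
  obtain ⟨hy0, hy1, hy2⟩ := hnz 4 (by decide) y0 y1 y2 hy hey
  have hprop : x2 * y1 = y2 * x1 → x2 * y0 = y2 * x0 → False := by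
    intro e1 e2
    apply hnp 3 4 (by decide) (y2 / x2)
    rw [← hx, ← hy, smul_add, smul_add, smul_smul, smul_smul, smul_smul]
    congr 1
    · congr 1
      · congr 1; field_simp; linear_combination -e2
      · congr 1; field_simp; linear_combination -e1
    · congr 1; field_simp
  have r1 : (x1 * y1 * (x2 * y0 - y2 * x0)) • a + (x0 * y0 * (x2 * y1 - y2 * x1)) • b = 0 := by
    have : (y0 * y1) • ((x1 * x2) • a + (x0 * x2) • b + (x0 * x1) • c) -
        (x0 * x1) • ((y1 * y2) • a + (y0 * y2) • b + (y0 * y1) • c) = 0 := by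
      rw [← hex, ← hey]; simp
    rw [← this]; module
  have d1 : x2 * y1 - y2 * x1 ≠ 0 := by
    intro hd
    rw [hd] at r1
    simp only [mul_zero, zero_smul, add_zero] at r1
    have := (smul_eq_zero.mp r1).resolve_right ha0
    have e2 : x2 * y0 - y2 * x0 = 0 := (mul_eq_zero.mp this).resolve_left (mul_ne_zero hx1 hy1)
    exact hprop (sub_eq_zero.mp hd) (sub_eq_zero.mp e2)
  obtain ⟨β, hβ⟩ : ∃ β : F, b = β • a := by
    refine ⟨-((x0 * y0 * (x2 * y1 - y2 * x1))⁻¹ * (x1 * y1 * (x2 * y0 - y2 * x0))), ?_⟩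
    have hD : x0 * y0 * (x2 * y1 - y2 * x1) ≠ 0 := mul_ne_zero (mul_ne_zero hx0 hy0) d1
    rw [neg_smul, mul_smul, eq_neg_of_add_eq_zero_left r1, smul_neg, neg_neg, inv_smul_smul₀ hD]
  obtain ⟨γ, hγ⟩ : ∃ γ : F, c = γ • a := by
    refine ⟨(x0 * x1)⁻¹ * (-(x1 * x2) - x0 * x2 * β), ?_⟩
    have : (x0 * x1) • c = (-(x1 * x2) - x0 * x2 * β) • a := by
      rw [hβ] at hex
      rw [← sub_eq_zero, hex]; module
    rw [mul_smul, ← this, inv_smul_smul₀ (mul_ne_zero hx0 hx1)]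
  have hβ0 : β ≠ 0 := by rintro rfl; exact hb0 (by simp [hβ])
  have hγ0 : γ ≠ 0 := by rintro rfl; exact hc0 (by simp [hγ])
  rw [card_zero_coord Q _ _ _ h3, ← count_B β γ hβ0 hγ0]
  refine Nat.card_congr (Equiv.subtypeEquiv (Equiv.refl _) ?_)
  intro t
  have : (t.2.1 * t.2.2) • a + (t.1 * t.2.2) • (β • a) + (t.1 * t.2.1) • (γ • a) =
    (t.2.1 * t.2.2 + β * (t.1 * t.2.2) + γ * (t.1 * t.2.1)) • a := by module
  rw [hexp, hβ, hγ, this, smul_eq_zero]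
  simp [ha0]

lemma exists_quad {F : Type*} [Field F] (K : Type*) [Field K] [Algebra F K]
    (f : MvPolynomial (Fin 3) K) (hf : f ∈ MvPolynomial.homogeneousSubmodule (Fin 3) K 2) :
    ∃ Q : QuadraticMap F (Fin 3 → F) K, ∀ x,
      Q x = MvPolynomial.aeval (fun i => algebraMap F K (x i)) f := by
  have hlin : ∀ f ∈ MvPolynomial.homogeneousSubmodule (Fin 3) K 1,
      ∃ l : (Fin 3 → F) →ₗ[F] K, ∀ x,
        l x = MvPolynomial.aeval (fun i => algebraMap F K (x i)) f := by
    intro f hf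
    rw [MvPolynomial.homogeneousSubmodule_one_eq_span_X] at hf
    induction hf using Submodule.span_induction with
    | mem x h =>
      obtain ⟨i, rfl⟩ := h
      exact ⟨(Algebra.linearMap F K).comp (LinearMap.proj i), fun x => by simp⟩
    | zero => exact ⟨0, fun x => by simp⟩
    | add x y _ _ h1 h2 =>
      obtain ⟨l1, h1⟩ := h1
      obtain ⟨l2, h2⟩ := h2
      exact ⟨l1 + l2, fun x => by simp [h1, h2]⟩
    | smul a x _ h =>
      obtain ⟨l, h⟩ := h
      exact ⟨a • l, fun x => by simp [h]⟩
  rw [← MvPolynomial.homogeneousSubmodule_one_pow, pow_two] at hf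
  induction hf using Submodule.mul_induction_on' with
  | mem_mul_mem m hm n hn =>
    obtain ⟨l1, h1⟩ := hlin m hm
    obtain ⟨l2, h2⟩ := hlin n hn
    exact ⟨QuadraticMap.linMulLin l1 l2, fun x => by simp [h1, h2]⟩
  | add x _ y _ h1 h2 =>
    obtain ⟨l1, h1⟩ := h1
    obtain ⟨l2, h2⟩ := h2
    exact ⟨l1 + l2, fun x => by simp [h1, h2]⟩

lemma card_vec {F K : Type*} [Field F] [Fintype F] [AddCommGroup K] [Module F K]
    (Q : QuadraticMap F (Fin 3 → F) K) (rep : Plane F → (Fin 3 → F))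
    (hrep : ∀ p : Plane F, ∃ h : rep p ≠ 0, Projectivization.mk F (rep p) h = p) :
    Nat.card {x // Q x = 0} =
      Nat.card {p // Q (rep p) = 0} * (Fintype.card F - 1) + 1 := by
  classical
  have h1 : Nat.card {x : {x // Q x = 0} // x.1 ≠ 0} =
      Nat.card ({p // Q (rep p) = 0} × Fˣ) := by
    symm
    refine Nat.card_congr (Equiv.ofBijective
      (fun t => ⟨⟨(t.2 : F) • rep t.1.1, by rw [Q.map_smul, t.1.2, smul_zero]⟩,
        smul_ne_zero t.2.ne_zero (hrep t.1.1).1⟩) ⟨?_, ?_⟩)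
    · rintro ⟨⟨p, hp⟩, a⟩ ⟨⟨p', hp'⟩, a'⟩ h
      simp only [Subtype.mk.injEq] at h
      obtain ⟨n, e⟩ := hrep p
      obtain ⟨n', e'⟩ := hrep p'
      have hpp : p = p' := by
        rw [← e, ← e', Projectivization.mk_eq_mk_iff']
        refine ⟨(a : F)⁻¹ * a', ?_⟩
        rw [mul_smul, ← h, inv_smul_smul₀ a.ne_zero]
      subst hpp
      have := smul_left_injective F n h
      simp [Units.ext this]
    · rintro ⟨⟨x, hx⟩, hx0⟩
      obtain ⟨n, e⟩ := hrep (Projectivization.mk F x hx0)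
      obtain ⟨a, ha⟩ := (Projectivization.mk_eq_mk_iff F _ _ _ _).mp e
      have ha' : (a : F) • x = rep (Projectivization.mk F x hx0) := ha
      refine ⟨⟨⟨Projectivization.mk F x hx0, by rw [← ha', Q.map_smul, hx, smul_zero]⟩, a⁻¹⟩, ?_⟩
      simp only [Subtype.mk.injEq]
      rw [← ha', Units.val_inv_eq_inv_val, inv_smul_smul₀ a.ne_zero]
  rw [Nat.card_prod, Nat.card_eq_fintype_card (α := Fˣ), Fintype.card_units] at h1
  rw [← h1]
  have h2 := Nat.card_congr (Equiv.sumCompl (fun x : {x // Q x = 0} => x.1 ≠ 0))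
  rw [Nat.card_sum] at h2
  rw [← h2]
  congr 1
  rw [Nat.card_eq_one_iff_unique]
  refine ⟨⟨?_⟩, ⟨⟨⟨0, by simp⟩, by simp⟩⟩⟩
  rintro ⟨⟨x, hx⟩, h⟩ ⟨⟨y, hy⟩, h'⟩
  simp only [not_not] at h h'
  subst h h'
  rfl

theorem veronese_ext_weights_mem
    {F : Type*} [Field F] [Fintype F] (q : ℕ) (hq : Fintype.card F = q) (hq4 : 4 ≤ q)
    (rep : Plane F → (Fin 3 → F))
    (hrep : ∀ p : Plane F, ∃ h : rep p ≠ 0, Projectivization.mk F (rep p) h = p)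
    (K : Type*) [Field K] [Fintype K] [Algebra F K] :
    ∀ g ∈ VeroneseCodeExt K rep, g ≠ 0 →
      wt g ∈ ({q ^ 2 - q, q ^ 2 - 1, q ^ 2, q ^ 2 + q - 3, q ^ 2 + q - 2, q ^ 2 + q - 1,
        q ^ 2 + q, q ^ 2 + q + 1} : Set ℕ) := by
  classical
  rintro g ⟨f, hf, rfl⟩ hg
  obtain ⟨Q, hQ⟩ := exists_quad (F := F) K f hf
  have hgQ : ∀ p, (LinearMap.pi fun p : Plane F =>
      (MvPolynomial.aeval (fun i => algebraMap F K (rep p i))).toLinearMap) f p = Q (rep p) := by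
    intro p; rw [hQ]; rfl
  have hex : ∃ x, Q x ≠ 0 := by
    by_contra! hcon
    exact hg (funext fun p => by rw [hgQ, hcon]; rfl)
  have hvec := card_vec Q rep hrep
  rw [hq] at hvec
  set N := Nat.card {p // Q (rep p) = 0} with hN
  have htot : wt (LinearMap.pi (fun p : Plane F =>
      (MvPolynomial.aeval (fun i => algebraMap F K (rep p i))).toLinearMap) f) + N =
        q ^ 2 + q + 1 := by
    have h2 := Nat.card_congr (Equiv.sumCompl (fun p : Plane F => Q (rep p) = 0))
    rw [Nat.card_sum, Projectivization.card_of_finrank F (Fin 3 → F) (n := 3) (by simp),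
      Nat.card_eq_fintype_card (α := F), hq] at h2
    have h3 : wt (LinearMap.pi (fun p : Plane F =>
      (MvPolynomial.aeval (fun i => algebraMap F K (rep p i))).toLinearMap) f) =
        Nat.card {p // ¬ Q (rep p) = 0} := by
      unfold wt
      simp only [hgQ]
      rfl
    rw [h3, hN]
    simp [Finset.sum_range_succ] at h2
    omega
  have key : N ≤ 4 ∨ N = q + 1 ∨ N = q + 2 ∨ N = 2 * q + 1 := by
    obtain ⟨r, rfl⟩ : ∃ r, q = r + 1 := ⟨q - 1, by omega⟩
    have hr : 0 < r := by omega
    simp only [Nat.add_sub_cancel] at hvec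
    by_cases hA : ∃ v w, LinearIndependent F ![v, w] ∧ Q v = 0 ∧ Q w = 0 ∧
        QuadraticMap.polar Q v w = 0
    · right
      obtain ⟨v, w, h, hv, hw, hvw⟩ := hA
      obtain ⟨m, hm, hc⟩ := case_A Q hex v w h hv hw hvw
      rw [hvec, hq, Nat.add_sub_cancel] at hc
      have : N = r + 2 + m := by
        apply Nat.eq_of_mul_eq_mul_right hr
        linarith
      rcases hm with rfl | rfl | rfl <;> omega
    · by_cases hN5 : N ≤ 4
      · exact Or.inl hN5
      right; left
      have hcard : Nat.card (Fin 5) ≤ Nat.card {p // Q (rep p) = 0} := by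
        simp only [Nat.card_eq_fintype_card (α := Fin 5), Fintype.card_fin]; omega
      have := Fintype.ofFinite {p // Q (rep p) = 0}
      rw [Nat.card_eq_fintype_card, Nat.card_eq_fintype_card] at hcard
      obtain ⟨e⟩ := Function.Embedding.nonempty_of_card_le hcard
      have hc := case_B Q (fun v w h hv hw hvw => hA ⟨v, w, h, hv, hw, hvw⟩)
        (fun i => rep (e i).1) (fun i => (e i).2) (by
          intro i j hij
          obtain ⟨n, en⟩ := hrep (e i).1
          obtain ⟨n', en'⟩ := hrep (e j).1
          rw [LinearIndependent.pair_iff' n]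
          intro a ha
          have : (e j).1 = (e i).1 := by
            rw [← en, ← en', Projectivization.mk_eq_mk_iff']
            exact ⟨a, ha⟩
          exact hij (e.injective (Subtype.ext this.symm)))
      rw [hvec, hq] at hc
      apply Nat.eq_of_mul_eq_mul_right hr
      linarith
  have hqq : 4 * q ≤ q ^ 2 := by nlinarith
  generalize wt (LinearMap.pi (fun p : Plane F =>
      (MvPolynomial.aeval (fun i => algebraMap F K (rep p i))).toLinearMap) f) = W at htot ⊢
  simp only [Set.mem_insert_iff, Set.mem_singleton_iff]
  omega
end
end
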